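/- There exist a constant C > 0 and a threshold N such that for every n ≥ 1 and every finite set A ⊆ ℝ^n with |A| ≥ N that contains no solution to (1/5)x₁ + (1/5)x₂ + (1/5)x₃ + (1/5)x₄ + (1/5)x₅ = x₆ with x₁, …, x₆ ∈ A pairwise distinct, one has |A + A| ≥ |A| · exp(C · (log |A|)^{1/7}). -/

import Mathlib

open Pointwise

noncomputable section

/-- The set of lattice (integer) points in `ℝ^n`. -/
def lat (n : ℕ) : Set (Fin n → ℝ) := {x | ∀ j, ∃ z : ℤ, x j = (z : ℝ)}

/-- The polyhedron determined by the subsystem of `A x ≤ b` indexed by `I`. -/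
def polyI {n m : ℕ} (A : Fin m → Fin n → ℝ) (b : Fin m → ℝ) (I : Set (Fin m)) :
    Set (Fin n → ℝ) := {x | ∀ i ∈ I, ∑ j, A i j * x j ≤ b i}

/-- The integer points of a set `S ⊆ ℝ^n`. -/
def intPts {n : ℕ} (S : Set (Fin n → ℝ)) : Set (Fin n → ℝ) := S ∩ lat n

/-- `c` is a valid Helly-type bound for dimension `n` and `k` integer points:
any polyhedron with exactly `k` integer points has a subsystem of at most `c`
inequalities with exactly the same integer points. -/
def HellyBound (n k c : ℕ) : Prop :=
  ∀ (m : ℕ) (A : Fin m → Fin n → ℝ) (b : Fin m → ℝ),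
    (intPts (polyI A b Set.univ)).Finite →
    (intPts (polyI A b Set.univ)).ncard = k →
    ∃ I : Finset (Fin m), I.card ≤ c ∧
      intPts (polyI A b (↑I : Set (Fin m))) = intPts (polyI A b Set.univ)

/-- The quantity `c(n,k)`: the least valid Helly-type bound. -/
def cnk (n k : ℕ) : ℕ := sInf {c | HellyBound n k c}

/-- A set of points is in convex position if no point of it lies in the convex
hull of the others. -/
def ConvexPos {n : ℕ} (V : Set (Fin n → ℝ)) : Prop :=
  ∀ v ∈ V, v ∉ convexHull ℝ (V \ {v})

/-- `iconv V = conv(V) ∩ ℤ^n`. -/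
def iconv {n : ℕ} (V : Set (Fin n → ℝ)) : Set (Fin n → ℝ) :=
  convexHull ℝ V ∩ lat n

/-- `ℓ(n,k)`: the smallest integer `s` such that every set `V ⊆ ℤ^n` in convex
position with `|V| = s` satisfies `|iconv(V) \ V| ≥ k`. -/
def ellnk (n k : ℕ) : ℕ :=
  sInf {s | ∀ V : Set (Fin n → ℝ), V ⊆ lat n → ConvexPos V → V.Finite →
    V.ncard = s → k ≤ (iconv V \ V).ncard}

/-- The set of midpoints of `V` that are not in `V`. -/
def midpts {n : ℕ} (V : Set (Fin n → ℝ)) : Set (Fin n → ℝ) :=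
  {p | ∃ x ∈ V, ∃ y ∈ V, p = (1/2 : ℝ) • (x + y)} \ V

/-- `μ_c(n,s)`: the minimum number of midpoints `|M(V)|` over all sets
`V ⊆ ℝ^n` in convex position with `|V| = s`. -/
def muc (n s : ℕ) : ℕ :=
  sInf {m | ∃ V : Set (Fin n → ℝ), ConvexPos V ∧ V.Finite ∧ V.ncard = s ∧
    (midpts V).ncard = m}

/-- `α(n,k)`: the maximum cardinality of a set `V ⊆ ℤ^n` in convex position
with `|iconv(V) \ V| = k`. -/
def alphank (n k : ℕ) : ℕ :=
  sSup {m | ∃ V : Set (Fin n → ℝ), V ⊆ lat n ∧ ConvexPos V ∧ V.Finite ∧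
    V.ncard = m ∧ (iconv V \ V).ncard = k}

/-- A system `A x ≤ b` is non-redundant if removing any single inequality
strictly increases the set of integer points. -/
def NonRedundant {n m : ℕ} (A : Fin m → Fin n → ℝ) (b : Fin m → ℝ) : Prop :=
  ∀ i : Fin m,
    intPts (polyI A b Set.univ) ⊂ intPts (polyI A b ({i}ᶜ : Set (Fin m)))

/-- The set of lattice (integer) points in Euclidean space `ℝ^n`. -/
def latE (n : ℕ) : Set (EuclideanSpace ℝ (Fin n)) := {x | ∀ j, ∃ z : ℤ, x j = (z : ℝ)}

set_option linter.unusedSectionVars false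

namespace SSix

section bohr
variable {G : Type} [AddCommGroup G] [Fintype G] [DecidableEq G]

/-- Bohr set with chordal radius. -/
def bohr (Γ : Finset (AddChar G ℂ)) (ρ : ℝ) : Finset G :=
  Finset.univ.filter (fun x => ∀ γ ∈ Γ, ‖γ x - 1‖ ≤ ρ)

lemma mem_bohr {Γ : Finset (AddChar G ℂ)} {ρ : ℝ} {x : G} :
    x ∈ bohr Γ ρ ↔ ∀ γ ∈ Γ, ‖γ x - 1‖ ≤ ρ := by
  simp [bohr]

lemma norm_char (γ : AddChar G ℂ) (x : G) : ‖γ x‖ = 1 := AddChar.norm_apply γ x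

lemma char_sub_norm (γ : AddChar G ℂ) (x y : G) : ‖γ (x - y) - 1‖ = ‖γ x - γ y‖ := by
  have h : γ x - γ y = (γ (x - y) - 1) * γ y := by
    rw [sub_mul, ← AddChar.map_add_eq_mul, sub_add_cancel, one_mul]
  rw [h, norm_mul, norm_char, mul_one]

lemma char_add_norm_le (γ : AddChar G ℂ) (x y : G) :
    ‖γ (x + y) - 1‖ ≤ ‖γ x - 1‖ + ‖γ y - 1‖ := by
  have h : γ (x + y) - 1 = (γ x - 1) * γ y + (γ y - 1) := by
    rw [AddChar.map_add_eq_mul]; ring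
  rw [h]
  refine (norm_add_le _ _).trans ?_
  rw [norm_mul, norm_char, mul_one]

lemma char_neg_norm (γ : AddChar G ℂ) (x : G) : ‖γ (-x) - 1‖ = ‖γ x - 1‖ := by
  have := char_sub_norm γ 0 x
  rw [zero_sub] at this
  rw [this, AddChar.map_zero_eq_one, norm_sub_rev]

lemma zero_mem_bohr {Γ : Finset (AddChar G ℂ)} {ρ : ℝ} (h : 0 ≤ ρ) : (0 : G) ∈ bohr Γ ρ := by
  simp [mem_bohr, h]

lemma neg_mem_bohr {Γ : Finset (AddChar G ℂ)} {ρ : ℝ} {x : G} (h : x ∈ bohr Γ ρ) :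
    -x ∈ bohr Γ ρ := by
  rw [mem_bohr] at *
  intro γ hγ
  rw [char_neg_norm]; exact h γ hγ

lemma add_mem_bohr {Γ : Finset (AddChar G ℂ)} {ρ ρ' : ℝ} {x y : G} (h : x ∈ bohr Γ ρ)
    (h' : y ∈ bohr Γ ρ') : x + y ∈ bohr Γ (ρ + ρ') := by
  rw [mem_bohr] at *
  intro γ hγ
  exact (char_add_norm_le γ x y).trans (add_le_add (h γ hγ) (h' γ hγ))

lemma sub_mem_bohr {Γ : Finset (AddChar G ℂ)} {ρ ρ' : ℝ} {x y : G} (h : x ∈ bohr Γ ρ)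
    (h' : y ∈ bohr Γ ρ') : x - y ∈ bohr Γ (ρ + ρ') := by
  rw [sub_eq_add_neg]; exact add_mem_bohr h (neg_mem_bohr h')

lemma bohr_mono {Γ : Finset (AddChar G ℂ)} {ρ ρ' : ℝ} (h : ρ ≤ ρ') : bohr Γ ρ ⊆ bohr Γ ρ' := by
  intro x hx
  rw [mem_bohr] at *
  exact fun γ hγ => (hx γ hγ).trans h

lemma bohr_anti {Γ Γ' : Finset (AddChar G ℂ)} {ρ ρ' : ℝ} (hΓ : Γ ⊆ Γ') (h : ρ ≤ ρ') :
    bohr Γ' ρ ⊆ bohr Γ ρ' := by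
  intro x hx
  rw [mem_bohr] at *
  exact fun γ hγ => (hx γ (hΓ hγ)).trans h

lemma bohr_card_pos {Γ : Finset (AddChar G ℂ)} {ρ : ℝ} (h : 0 ≤ ρ) : 0 < (bohr Γ ρ).card :=
  Finset.card_pos.mpr ⟨0, zero_mem_bohr h⟩

lemma bohr_two (Γ : Finset (AddChar G ℂ)) {ρ : ℝ} (h : 2 ≤ ρ) : bohr Γ ρ = Finset.univ := by
  ext x
  simp only [mem_bohr, Finset.mem_univ, iff_true]
  intro γ _
  refine (norm_sub_le _ _).trans ?_
  rw [norm_char, norm_one]; linarith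

lemma floor_mem (w ρ : ℝ) (hρ : 0 < ρ) (h : |w| ≤ ρ) :
    ⌊w * (3 / ρ)⌋ ∈ Finset.Icc (-3 : ℤ) 3 := by
  have h3 : |w * (3 / ρ)| ≤ 3 := by
    rw [abs_mul, abs_of_pos (by positivity : 0 < 3 / ρ)]
    calc |w| * (3 / ρ) ≤ ρ * (3 / ρ) := by gcongr
      _ = 3 := by field_simp
  rw [abs_le] at h3
  rw [Finset.mem_Icc]
  constructor
  · rw [Int.le_floor]; push_cast; linarith [h3.1]
  · have : ((⌊w * (3 / ρ)⌋ : ℤ) : ℝ) ≤ ((3 : ℤ) : ℝ) := by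
      push_cast; exact (Int.floor_le _).trans h3.2
    exact_mod_cast this

lemma floor_close (w w' ρ : ℝ) (hρ : 0 < ρ) (h : ⌊w * (3 / ρ)⌋ = ⌊w' * (3 / ρ)⌋) :
    |w - w'| ≤ ρ / 3 := by
  have h1 := Int.abs_sub_lt_one_of_floor_eq_floor h
  rw [← sub_mul, abs_mul, abs_of_pos (by positivity : 0 < 3 / ρ)] at h1
  have : |w - w'| = |w - w'| * (3 / ρ) * (ρ / 3) := by field_simp
  rw [this]
  calc |w - w'| * (3 / ρ) * (ρ / 3) ≤ 1 * (ρ / 3) := by gcongr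
    _ = ρ / 3 := one_mul _

/-- Covering: doubling of Bohr sets. -/
lemma bohr_half (Γ : Finset (AddChar G ℂ)) {ρ : ℝ} (hρ : 0 < ρ) :
    (bohr Γ ρ).card ≤ 49 ^ Γ.card * (bohr Γ (ρ / 2)).card := by
  classical
  let cell : Finset (ℤ × ℤ) := Finset.Icc (-3 : ℤ) 3 ×ˢ Finset.Icc (-3 : ℤ) 3
  let F : G → (Γ → ℤ × ℤ) := fun x γ =>
    (⌊((γ : AddChar G ℂ) x - 1).re * (3 / ρ)⌋, ⌊((γ : AddChar G ℂ) x - 1).im * (3 / ρ)⌋)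
  have hmaps : ∀ x ∈ bohr Γ ρ, F x ∈ Fintype.piFinset (fun _ : Γ => cell) := by
    intro x hx
    rw [Fintype.mem_piFinset]
    intro γ
    have hh := (mem_bohr.mp hx) γ γ.2
    simp only [cell, F, Finset.mem_product]
    exact ⟨floor_mem _ _ hρ ((Complex.abs_re_le_norm _).trans hh),
      floor_mem _ _ hρ ((Complex.abs_im_le_norm _).trans hh)⟩
  have hfib : ∀ c ∈ Fintype.piFinset (fun _ : Γ => cell),
      ((bohr Γ ρ).filter (fun x => F x = c)).card ≤ (bohr Γ (ρ / 2)).card := by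
    intro c _
    rcases ((bohr Γ ρ).filter (fun x => F x = c)).eq_empty_or_nonempty with h | ⟨x0, hx0⟩
    · rw [h]; simp
    · refine Finset.card_le_card_of_injOn (fun x => x - x0) ?_ ?_
      · intro x hx
        have hx' := (Finset.mem_filter.mp (Finset.mem_coe.mp hx)).2
        have hx0' := (Finset.mem_filter.mp hx0).2
        rw [Finset.mem_coe, mem_bohr]
        intro γ hγ
        have e : F x ⟨γ, hγ⟩ = F x0 ⟨γ, hγ⟩ := by rw [hx', hx0']
        simp only [F, Prod.mk.injEq] at e
        rw [char_sub_norm]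
        have e1 := floor_close _ _ _ hρ e.1
        have e2 := floor_close _ _ _ hρ e.2
        have : γ x - γ x0 = (γ x - 1) - (γ x0 - 1) := by ring
        rw [this]
        set z := (γ x - 1) - (γ x0 - 1)
        have hz1 : |z.re| ≤ ρ / 3 := by simpa [z] using e1
        have hz2 : |z.im| ≤ ρ / 3 := by simpa [z] using e2
        have hn : ‖z‖ ^ 2 = z.re ^ 2 + z.im ^ 2 := by
          rw [Complex.sq_norm, Complex.normSq_apply]; ring
        have h1 : z.re ^ 2 ≤ (ρ / 3) ^ 2 := by
          rw [← sq_abs]; gcongr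
        have h2 : z.im ^ 2 ≤ (ρ / 3) ^ 2 := by
          rw [← sq_abs]; gcongr
        refine abs_le_of_sq_le_sq' ?_ (by positivity) |>.2
        nlinarith
      · intro x _ y _ hxy
        exact sub_left_injective hxy
  have := Finset.card_le_mul_card_image_of_maps_to hmaps _ hfib
  refine this.trans ?_
  rw [Fintype.card_piFinset]
  simp only [cell, Finset.card_product, Int.card_Icc, Finset.prod_const, Finset.card_univ,
    Fintype.card_coe]
  norm_num
  rw [mul_comm]
  rw [show Int.toNat 7 = 7 from rfl]

lemma bohr_card_lower (Γ : Finset (AddChar G ℂ)) (j : ℕ) :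
    Fintype.card G ≤ 49 ^ (Γ.card * j) * (bohr Γ (2 / 2 ^ j)).card := by
  induction j with
  | zero => simp [bohr_two]
  | succ j ih =>
    refine ih.trans ?_
    have := bohr_half Γ (ρ := 2 / 2 ^ j) (by positivity)
    calc 49 ^ (Γ.card * j) * (bohr Γ (2 / 2 ^ j)).card
        ≤ 49 ^ (Γ.card * j) * (49 ^ Γ.card * (bohr Γ (2 / 2 ^ j / 2)).card) := by gcongr
      _ = _ := by
        rw [show (2 : ℝ) / 2 ^ (j + 1) = 2 / 2 ^ j / 2 by rw [pow_succ]; field_simp]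
        rw [mul_add, pow_add, mul_one, mul_assoc]

/-- regular radius -/
def Reg (D : ℕ) (c : ℝ) (Γ : Finset (AddChar G ℂ)) (ρ : ℝ) : Prop :=
  ((bohr Γ (ρ + c * ρ / (20 * D))).card : ℝ) ≤ (1 + c) * (bohr Γ ρ).card

lemma exists_reg (D : ℕ) (hD : 1 ≤ D) (c : ℝ) (hc : 0 < c) (hc1 : c ≤ 1)
    (Γ : Finset (AddChar G ℂ)) (hΓ : Γ.card ≤ D) (ρ : ℝ) (hρ : 0 < ρ) :
    ∃ ρ', ρ / 2 ≤ ρ' ∧ ρ' ≤ ρ ∧ Reg D c Γ ρ' := by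
  by_contra hcon
  push Not at hcon
  have hD0 : (1 : ℝ) ≤ D := by exact_mod_cast hD
  set κ : ℝ := c * ρ / (20 * D) with hκ
  have hκ0 : 0 < κ := by positivity
  -- number of steps
  set J : ℕ := ⌊10 * D / c⌋₊ with hJ
  have hJ1 : (J : ℝ) ≤ 10 * D / c := Nat.floor_le (by positivity)
  have hJ2 : 10 * D / c < J + 1 := Nat.lt_floor_add_one _
  have hJκ : J * κ ≤ ρ / 2 := by
    calc J * κ ≤ (10 * D / c) * κ := by gcongr
      _ = ρ / 2 := by rw [hκ]; field_simp; norm_num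
  have hstep : ∀ j : ℕ, j ≤ J →
      (1 + c) ^ j * ((bohr Γ (ρ / 2)).card : ℝ) ≤ (bohr Γ (ρ / 2 + j * κ)).card := by
    intro j
    induction j with
    | zero => intro _; simp
    | succ j ih =>
      intro hj
      have hj' : ((j : ℝ) + 1) ≤ J := by exact_mod_cast hj
      have hr : ρ / 2 + j * κ ≤ ρ := by nlinarith
      have h1 := hcon (ρ / 2 + j * κ) (by nlinarith [mul_nonneg (Nat.cast_nonneg (α := ℝ) j) hκ0.le]) hr
      unfold Reg at h1
      push Not at h1
      have h2 : c * (ρ / 2 + j * κ) / (20 * D) ≤ κ := by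
        rw [hκ]; gcongr
      have h3 : ((bohr Γ (ρ / 2 + j * κ + c * (ρ / 2 + j * κ) / (20 * D))).card : ℝ) ≤
          (bohr Γ (ρ / 2 + (j + 1 : ℕ) * κ)).card := by
        have := Finset.card_le_card (bohr_mono (Γ := Γ)
          (show ρ / 2 + j * κ + c * (ρ / 2 + j * κ) / (20 * D) ≤ ρ / 2 + (j + 1 : ℕ) * κ by
            push_cast; nlinarith))
        exact_mod_cast this
      have h4 := ih (by omega)
      calc (1 + c) ^ (j + 1) * ((bohr Γ (ρ / 2)).card : ℝ)
          = (1 + c) * ((1 + c) ^ j * ((bohr Γ (ρ / 2)).card : ℝ)) := by ring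
        _ ≤ (1 + c) * (bohr Γ (ρ / 2 + j * κ)).card := by gcongr
        _ ≤ _ := h1.le.trans h3
  have hJJ := hstep J le_rfl
  have hup : ((bohr Γ (ρ / 2 + J * κ)).card : ℝ) ≤ 49 ^ D * (bohr Γ (ρ / 2)).card := by
    have h1 := Finset.card_le_card (bohr_mono (Γ := Γ) (show ρ / 2 + J * κ ≤ ρ by linarith))
    have h2 := bohr_half Γ hρ
    have h3 : 49 ^ Γ.card * (bohr Γ (ρ / 2)).card ≤ 49 ^ D * (bohr Γ (ρ / 2)).card := by
      gcongr; norm_num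
    exact_mod_cast h1.trans (h2.trans h3)
  have hpos : (0 : ℝ) < (bohr Γ (ρ / 2)).card := by
    exact_mod_cast bohr_card_pos (by positivity)
  have hle : (1 + c) ^ J ≤ (49 : ℝ) ^ D := le_of_mul_le_mul_right (hJJ.trans hup) hpos
  -- also the step J violates; contradiction via logs
  have hlog : (J : ℝ) * Real.log (1 + c) ≤ D * Real.log 49 := by
    have := Real.log_le_log (by positivity) hle
    rwa [Real.log_pow, Real.log_pow] at this
  have hl1 : c * (1 / 2) ≤ Real.log (1 + c) := by
    have := Real.one_sub_inv_le_log_of_pos (show 0 < 1 + c by linarith)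
    have e : 1 - (1 + c)⁻¹ = c / (1 + c) := by field_simp; ring
    rw [e] at this
    refine le_trans ?_ this
    rw [le_div_iff₀ (by linarith)]; nlinarith
  have hl2 : Real.log 49 ≤ 4 := by
    rw [Real.log_le_iff_le_exp (by norm_num)]
    have := Real.exp_one_gt_d9
    have e : Real.exp 4 = Real.exp 1 ^ 4 := by rw [← Real.exp_nat_mul]; norm_num
    rw [e]
    calc (49 : ℝ) ≤ 2.7 ^ 4 := by norm_num
      _ ≤ _ := by gcongr; linarith
  have hb : (10 * D / c - 1) * (c * (1 / 2)) ≤ D * 4 := by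
    calc (10 * D / c - 1) * (c * (1 / 2)) ≤ J * (c * (1 / 2)) := by
            gcongr; linarith
      _ ≤ J * Real.log (1 + c) := by gcongr
      _ ≤ D * Real.log 49 := hlog
      _ ≤ D * 4 := by gcongr
  have e : (10 * D / c - 1) * (c * (1 / 2)) = 5 * D - c / 2 := by field_simp; ring
  rw [e] at hb
  linarith

end bohr
end SSix

namespace SSix

section cs

lemma exp_mul_le_cosh (l y : ℝ) (h1 : -1 ≤ y) (h2 : y ≤ 1) :
    Real.exp (l * y) ≤ Real.cosh l + y * Real.sinh l := by
  have := convexOn_exp.2 (Set.mem_univ l) (Set.mem_univ (-l))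
    (show 0 ≤ (1 + y) / 2 by linarith) (show 0 ≤ (1 - y) / 2 by linarith) (by ring)
  simp only [smul_eq_mul] at this
  have e : (1 + y) / 2 * l + (1 - y) / 2 * -l = l * y := by ring
  rw [e] at this
  rw [Real.cosh_eq, Real.sinh_eq]
  linarith

variable {G : Type} [AddCommGroup G] [Fintype G] [DecidableEq G]

def ind (Q : Finset G) (v : G) : ℝ := if v ∈ Q then 1 else 0

lemma ind_nonneg (Q : Finset G) (v : G) : 0 ≤ ind Q v := by unfold ind; split <;> norm_num
lemma ind_le (Q : Finset G) (v : G) : ind Q v ≤ 1 := by unfold ind; split <;> norm_num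

def gfun (Q A2 : Finset G) (v : G) : ℝ := (∑ a ∈ A2, ind Q (v + a)) / A2.card

def hfun (Q A1 A2 : Finset G) (u : G) : ℝ := (∑ a ∈ A1, gfun Q A2 (a + u)) / A1.card

lemma hoeff (A : Finset G) (hA : A.Nonempty) (f : G → ℝ) (h0 : ∀ x, 0 ≤ f x) (h1 : ∀ x, f x ≤ 1)
    (l : ℝ) :
    ∑ a ∈ A, Real.exp (l * (f a - (∑ b ∈ A, f b) / A.card)) ≤ A.card * Real.exp (l ^ 2 / 2) := by
  have hc : (0 : ℝ) < A.card := by exact_mod_cast hA.card_pos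
  set μ := (∑ b ∈ A, f b) / A.card with hμ
  have hμ0 : 0 ≤ μ := div_nonneg (Finset.sum_nonneg fun x _ => h0 x) hc.le
  have hμ1 : μ ≤ 1 := by
    rw [hμ, div_le_one hc]
    calc ∑ b ∈ A, f b ≤ ∑ b ∈ A, (1 : ℝ) := Finset.sum_le_sum fun x _ => h1 x
      _ = A.card := by simp
  calc ∑ a ∈ A, Real.exp (l * (f a - μ))
      ≤ ∑ a ∈ A, (Real.cosh l + (f a - μ) * Real.sinh l) := by
        refine Finset.sum_le_sum fun x _ => exp_mul_le_cosh _ _ ?_ ?_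
        · linarith [h0 x]
        · linarith [h1 x]
    _ = A.card * Real.cosh l := by
        rw [Finset.sum_add_distrib, ← Finset.sum_mul, Finset.sum_sub_distrib]
        simp only [Finset.sum_const, nsmul_eq_mul]
        have : ∑ b ∈ A, f b = A.card * μ := by rw [hμ]; field_simp
        rw [this]; ring
    _ ≤ _ := by
        gcongr
        exact Real.cosh_le_exp_half_sq l

lemma hoeff_pow (A : Finset G) (hA : A.Nonempty) (f : G → ℝ) (h0 : ∀ x, 0 ≤ f x)
    (h1 : ∀ x, f x ≤ 1) (l : ℝ) (k : ℕ) :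
    ∑ a ∈ Fintype.piFinset (fun _ : Fin k => A),
      Real.exp (l * ∑ i, (f (a i) - (∑ b ∈ A, f b) / A.card)) ≤
      (A.card : ℝ) ^ k * Real.exp (k * l ^ 2 / 2) := by
  have h := hoeff A hA f h0 h1 l
  have e := Finset.prod_univ_sum (fun _ : Fin k => A)
    (fun (_ : Fin k) a => Real.exp (l * (f a - (∑ b ∈ A, f b) / A.card)))
  have e2 : ∑ a ∈ Fintype.piFinset (fun _ : Fin k => A),
      Real.exp (l * ∑ i, (f (a i) - (∑ b ∈ A, f b) / A.card)) =
      ∑ a ∈ Fintype.piFinset (fun _ : Fin k => A),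
      ∏ i, Real.exp (l * (f (a i) - (∑ b ∈ A, f b) / A.card)) := by
    refine Finset.sum_congr rfl fun a _ => ?_
    rw [Finset.mul_sum, Real.exp_sum]
  rw [e2, ← e, Finset.prod_const, Finset.card_univ, Fintype.card_fin]
  calc _ ≤ (A.card * Real.exp (l ^ 2 / 2)) ^ k := by
        refine pow_le_pow_left₀ (Finset.sum_nonneg fun x _ => (Real.exp_pos _).le) h k
    _ = _ := by
        rw [mul_pow, ← Real.exp_nat_mul]; congr 2; ring

/-- Croot–Sisask sampling. -/
lemma croot_sisask (A1 A2 S Q : Finset G) (h1 : A1.Nonempty) (h2 : A2.Nonempty)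
    (R θ : ℝ) (hR : 1 ≤ R) (hθ : 0 < θ) (k : ℕ) (hk : 2 * Real.log (5 * R) ≤ k * θ ^ 2)
    (hV : ((Finset.univ.filter (fun v => ∃ a ∈ A2, v + a ∈ Q)).card : ℝ) ≤ R * A1.card) :
    ∃ T ⊆ S, (S.card : ℝ) * (A2.card : ℝ) ^ k ≤ 2 * ((A2 + S).card : ℝ) ^ k * T.card ∧
      ∀ s ∈ T, ∀ s' ∈ T, ∀ u, |hfun Q A1 A2 (u + s) - hfun Q A1 A2 (u + s')| ≤ 2 * θ := by
  classical
  set V := Finset.univ.filter (fun v => ∃ a ∈ A2, v + a ∈ Q) with hVdef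
  have hlog : 0 < Real.log (5 * R) := Real.log_pos (by linarith)
  have hk0 : (0 : ℝ) < k := by
    by_contra h
    have : (k : ℝ) = 0 := le_antisymm (not_lt.mp h) (Nat.cast_nonneg _)
    rw [this] at hk; linarith
  have hA1 : (0 : ℝ) < A1.card := by exact_mod_cast h1.card_pos
  have hA2 : (0 : ℝ) < A2.card := by exact_mod_cast h2.card_pos
  let Dv : (Fin k → G) → G → ℝ := fun a v => ∑ i, (ind Q (v + a i) - gfun Q A2 v)
  let Φ : (Fin k → G) → ℝ := fun a => ∑ v ∈ V, (Real.exp (θ * Dv a v) + Real.exp (-θ * Dv a v))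
  set P := Fintype.piFinset (fun _ : Fin k => A2) with hP
  have hPc : (P.card : ℝ) = (A2.card : ℝ) ^ k := by
    rw [hP, Fintype.card_piFinset]; simp
  set E := Real.exp (k * θ ^ 2 / 2) with hE
  have hEpos : 0 < E := Real.exp_pos _
  have hsum : ∑ a ∈ P, Φ a ≤ V.card * (2 * ((A2.card : ℝ) ^ k * E)) := by
    simp only [Φ]
    rw [Finset.sum_comm]
    rw [← nsmul_eq_mul]
    refine Finset.sum_le_card_nsmul _ _ _ fun v _ => ?_
    rw [Finset.sum_add_distrib]
    have e1 := hoeff_pow A2 h2 (fun a => ind Q (v + a)) (fun x => ind_nonneg _ _)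
      (fun x => ind_le _ _) θ k
    have e2 := hoeff_pow A2 h2 (fun a => ind Q (v + a)) (fun x => ind_nonneg _ _)
      (fun x => ind_le _ _) (-θ) k
    rw [neg_sq] at e2
    have := add_le_add e1 e2
    simp only [Dv, gfun]
    linarith
  have hΦ0 : ∀ a, 0 ≤ Φ a := fun a => Finset.sum_nonneg fun v _ => by positivity
  set M : ℝ := 4 * (R * A1.card) * E with hM
  have hMpos : 0 < M := by positivity
  set Good := P.filter (fun a => Φ a ≤ M) with hGood
  have hgood : (A2.card : ℝ) ^ k ≤ 2 * Good.card := by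
    have hb : ((P.filter (fun a => ¬ Φ a ≤ M)).card : ℝ) * M ≤ ∑ a ∈ P, Φ a := by
      calc _ = ∑ a ∈ P.filter (fun a => ¬ Φ a ≤ M), M := by simp
        _ ≤ ∑ a ∈ P.filter (fun a => ¬ Φ a ≤ M), Φ a := by
          refine Finset.sum_le_sum fun a ha => ?_
          exact (not_le.mp (Finset.mem_filter.mp ha).2).le
        _ ≤ _ := Finset.sum_le_sum_of_subset_of_nonneg (Finset.filter_subset _ _)
          fun a _ _ => hΦ0 a
    have hsplit : ((Good.card : ℕ) : ℝ) + ((P.filter (fun a => ¬ Φ a ≤ M)).card : ℝ) = P.card := by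
      have := Finset.card_filter_add_card_filter_not (s := P) (fun a => Φ a ≤ M)
      exact_mod_cast this
    have h3 : ((P.filter (fun a => ¬ Φ a ≤ M)).card : ℝ) * M ≤ (A2.card : ℝ) ^ k / 2 * M := by
      refine hb.trans (hsum.trans ?_)
      calc V.card * (2 * ((A2.card : ℝ) ^ k * E))
          ≤ (R * A1.card) * (2 * ((A2.card : ℝ) ^ k * E)) := by gcongr
        _ = _ := by rw [hM]; ring
    have h4 := le_of_mul_le_mul_right h3 hMpos
    rw [hPc] at hsplit
    linarith
  -- Jensen
  have hjen : ∀ a ∈ Good, ∀ w, (∑ x ∈ A1, |Dv a (x + w)|) / A1.card ≤ k * θ := by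
    intro a ha w
    have hΦa : Φ a ≤ M := (Finset.mem_filter.mp ha).2
    have haP : ∀ i, a i ∈ A2 := by
      have := (Finset.mem_filter.mp ha).1
      rw [hP, Fintype.mem_piFinset] at this
      exact this
    have hw : ∑ x ∈ A1, (1 : ℝ) / A1.card = 1 := by
      rw [Finset.sum_const, nsmul_eq_mul]; field_simp
    have hJ := convexOn_exp.map_sum_le (t := A1) (w := fun _ => (1 : ℝ) / A1.card)
      (p := fun x => θ * |Dv a (x + w)|) (fun _ _ => by positivity) hw (fun _ _ => Set.mem_univ _)
    simp only [smul_eq_mul] at hJ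
    rw [← Finset.mul_sum, ← Finset.mul_sum, ← Finset.mul_sum] at hJ
    have hpt : ∀ x ∈ A1, Real.exp (θ * |Dv a (x + w)|) ≤ 1 +
        (if x + w ∈ V then (Real.exp (θ * Dv a (x + w)) + Real.exp (-θ * Dv a (x + w))) else 0) := by
      intro x _
      split_ifs with hxV
      · rcases abs_cases (Dv a (x + w)) with ⟨h, _⟩ | ⟨h, _⟩
        · rw [h]; linarith [Real.exp_pos (-θ * Dv a (x + w))]
        · rw [h]
          have : θ * -Dv a (x + w) = -θ * Dv a (x + w) := by ring
          rw [this]; linarith [Real.exp_pos (θ * Dv a (x + w))]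
      · have hnot : ∀ b ∈ A2, x + w + b ∉ Q := by
          intro b hb hq
          exact hxV (by rw [hVdef, Finset.mem_filter]; exact ⟨Finset.mem_univ _, b, hb, hq⟩)
        have hg0 : gfun Q A2 (x + w) = 0 := by
          unfold gfun
          rw [Finset.sum_eq_zero, zero_div]
          intro b hb; simp [ind, hnot b hb]
        have : Dv a (x + w) = 0 := by
          simp only [Dv]
          refine Finset.sum_eq_zero fun i _ => ?_
          rw [hg0]; simp [ind, hnot _ (haP i)]
        rw [this]; simp
    have hsum2 : ∑ x ∈ A1, Real.exp (θ * |Dv a (x + w)|) ≤ A1.card + Φ a := by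
      refine (Finset.sum_le_sum hpt).trans ?_
      rw [Finset.sum_add_distrib]
      simp only [Finset.sum_const, nsmul_eq_mul, mul_one]
      gcongr
      rw [← Finset.sum_filter]
      simp only [Φ]
      have := Finset.sum_image (s := A1.filter (fun x => x + w ∈ V)) (g := fun x => x + w)
        (f := fun v => Real.exp (θ * Dv a v) + Real.exp (-θ * Dv a v))
        (fun x _ y _ h => add_right_cancel h)
      rw [← this]
      refine Finset.sum_le_sum_of_subset_of_nonneg ?_ fun v _ _ => by positivity
      intro v hv
      obtain ⟨x, hx, rfl⟩ := Finset.mem_image.mp hv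
      exact (Finset.mem_filter.mp hx).2
    have hfin : Real.exp (1 / A1.card * (θ * ∑ x ∈ A1, |Dv a (x + w)|)) ≤ 5 * R * E := by
      have hE1 : 1 ≤ E := Real.one_le_exp (by positivity)
      have hRE : 1 ≤ R * E := by nlinarith
      calc _ ≤ 1 / A1.card * ∑ x ∈ A1, Real.exp (θ * |Dv a (x + w)|) := by
            convert hJ using 3
        _ ≤ 1 / A1.card * (A1.card + M) := by gcongr; linarith
        _ = 1 + 4 * R * E := by rw [hM]; field_simp
        _ ≤ _ := by linarith
    have hl := Real.log_le_log (Real.exp_pos _) hfin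
    rw [Real.log_exp, Real.log_mul (by positivity) hEpos.ne', hE, Real.log_exp] at hl
    have h6 : θ * ((∑ x ∈ A1, |Dv a (x + w)|) / A1.card) ≤ θ * (k * θ) := by
      calc _ = 1 / A1.card * (θ * ∑ x ∈ A1, |Dv a (x + w)|) := by ring
        _ ≤ _ := hl
        _ ≤ _ := by nlinarith
    exact le_of_mul_le_mul_left h6 hθ
  -- pigeonhole
  let T : (Fin k → G) → Finset G := fun b => S.filter (fun s => (fun i => b i - s) ∈ Good)
  have hpig : ∃ b, (S.card : ℝ) * (A2.card : ℝ) ^ k ≤ 2 * ((A2 + S).card : ℝ) ^ k * (T b).card := by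
    by_contra hcon
    push Not at hcon
    set PP := Fintype.piFinset (fun _ : Fin k => A2 + S) with hPP
    have hPPc : (PP.card : ℝ) = ((A2 + S).card : ℝ) ^ k := by
      rw [hPP, Fintype.card_piFinset]; simp
    have hmaps : ∀ q ∈ Good ×ˢ S, (fun i => q.1 i + q.2) ∈ PP := by
      intro q hq
      rw [Finset.mem_product] at hq
      rw [hPP, Fintype.mem_piFinset]
      intro i
      refine Finset.add_mem_add ?_ hq.2
      have := (Finset.mem_filter.mp hq.1).1
      rw [hP, Fintype.mem_piFinset] at this
      exact this i
    have hc := Finset.card_eq_sum_card_fiberwise hmaps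
    have hle : ∀ b ∈ PP, ((Good ×ˢ S).filter (fun q => (fun i => q.1 i + q.2) = b)).card ≤
        (T b).card := by
      intro b _
      refine Finset.card_le_card_of_injOn (fun q => q.2) ?_ ?_
      · intro q hq
        rw [Finset.mem_coe, Finset.mem_filter, Finset.mem_product] at hq
        rw [Finset.mem_coe, Finset.mem_filter]
        refine ⟨hq.1.2, ?_⟩
        have : (fun i => b i - q.2) = q.1 := by
          funext i; rw [← hq.2]; simp
        rw [this]; exact hq.1.1
      · intro q hq q' hq' hqq
        rw [Finset.mem_coe, Finset.mem_filter] at hq hq'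
        refine Prod.ext ?_ hqq
        funext i
        have e1 := congrFun hq.2 i
        have e2 := congrFun hq'.2 i
        simp only at e1 e2 hqq
        rw [hqq] at e1
        exact add_right_cancel (e1.trans e2.symm)
    have hc2 : (Good.card : ℝ) * S.card ≤ ∑ b ∈ PP, ((T b).card : ℝ) := by
      rw [Finset.card_product] at hc
      have := hc.le.trans (Finset.sum_le_sum hle)
      exact_mod_cast this
    rcases S.eq_empty_or_nonempty with hS | hS
    · have := hcon (fun _ => 0)
      rw [hS] at this
      simp only [Finset.card_empty, Nat.cast_zero, zero_mul] at this
      have h0 : 0 ≤ 2 * ((A2 + (∅ : Finset G)).card : ℝ) ^ k * (T (fun _ => 0)).card := by positivity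
      rw [hS] at *
      linarith
    · have hne : (A2 + S).Nonempty := h2.add hS
      have hAS : (0 : ℝ) < ((A2 + S).card : ℝ) ^ k := by
        have : (0 : ℝ) < (A2 + S).card := by exact_mod_cast hne.card_pos
        positivity
      have hPPne : PP.Nonempty := by
        rw [← Finset.card_pos]; rw [← hPPc] at hAS; exact_mod_cast hAS
      have hlt : ∑ b ∈ PP, 2 * ((A2 + S).card : ℝ) ^ k * ((T b).card : ℝ) <
          ∑ b ∈ PP, (S.card : ℝ) * (A2.card : ℝ) ^ k :=
        Finset.sum_lt_sum_of_nonempty hPPne fun b _ => hcon b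
      rw [← Finset.mul_sum, Finset.sum_const, nsmul_eq_mul, hPPc] at hlt
      have : 2 * ((A2 + S).card : ℝ) ^ k * ((Good.card : ℝ) * S.card) <
          ((A2 + S).card : ℝ) ^ k * ((S.card : ℝ) * (A2.card : ℝ) ^ k) :=
        lt_of_le_of_lt (by gcongr) hlt
      have h9 : ((A2 + S).card : ℝ) ^ k * ((S.card : ℝ) * (A2.card : ℝ) ^ k) ≤
          ((A2 + S).card : ℝ) ^ k * ((S.card : ℝ) * (2 * Good.card)) := by gcongr
      linarith
  obtain ⟨b, hb⟩ := hpig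
  refine ⟨T b, Finset.filter_subset _ _, hb, ?_⟩
  -- approximate
  have hap : ∀ s ∈ T b, ∀ u, |hfun Q A1 A2 (u + s) -
      (∑ x ∈ A1, (∑ i, ind Q (x + u + b i)) / k) / A1.card| ≤ θ := by
    intro s hs u
    have hsG := (Finset.mem_filter.mp hs).2
    have := hjen _ hsG (u + s)
    unfold hfun
    rw [← sub_div, ← Finset.sum_sub_distrib, abs_div, abs_of_pos hA1]
    calc _ ≤ (∑ x ∈ A1, |Dv (fun i => b i - s) (x + (u + s))| / k) / A1.card := by
          gcongr
          refine (Finset.abs_sum_le_sum_abs _ _).trans (le_of_eq ?_)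
          refine Finset.sum_congr rfl fun x _ => ?_
          rw [← abs_of_pos hk0, ← abs_div, abs_of_pos hk0, abs_sub_comm]
          congr 1
          simp only [Dv]
          rw [Finset.sum_sub_distrib]
          simp only [Finset.sum_const, Finset.card_univ, Fintype.card_fin, nsmul_eq_mul]
          rw [sub_div, mul_div_assoc, mul_div_cancel₀ _ hk0.ne']
          congr 2
          refine Finset.sum_congr rfl fun i _ => ?_
          congr 1; abel
      _ = ((∑ x ∈ A1, |Dv (fun i => b i - s) (x + (u + s))|) / A1.card) / k := by
          rw [← Finset.sum_div]; ring
      _ ≤ (k * θ) / k := by gcongr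
      _ = θ := by field_simp
  intro s hs s' hs' u
  have e1 := hap s hs u
  have e2 := hap s' hs' u
  rw [abs_le] at *
  constructor <;> linarith [e1.1, e1.2, e2.1, e2.2]

end cs
end SSix

namespace SSix

section fourier
variable {G : Type} [AddCommGroup G] [Fintype G] [DecidableEq G]

/-- average of a character over a set -/
def cavg (T : Finset G) (γ : AddChar G ℂ) : ℂ := (∑ t ∈ T, γ t) / T.card

lemma char_conj (γ : AddChar G ℂ) (x : G) : (starRingEnd ℂ) (γ x) = γ (-x) :=
  (AddChar.map_neg_eq_conj γ x).symm

lemma sum_neg_norm (X : Finset G) (γ : AddChar G ℂ) :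
    ‖∑ x ∈ X, γ (-x)‖ = ‖∑ x ∈ X, γ x‖ := by
  rw [← RCLike.norm_conj (∑ x ∈ X, γ x), map_sum]
  simp only [char_conj]

lemma parseval (X : Finset G) :
    ∑ γ : AddChar G ℂ, ‖∑ x ∈ X, γ x‖ ^ 2 = (Fintype.card G : ℝ) * X.card := by
  have h : ∀ γ : AddChar G ℂ, ((‖∑ x ∈ X, γ x‖ ^ 2 : ℝ) : ℂ) = ∑ x ∈ X, ∑ y ∈ X, γ (x - y) := by
    intro γ
    push_cast
    rw [← Complex.mul_conj', map_sum, Finset.sum_mul_sum]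
    refine Finset.sum_congr rfl fun x _ => Finset.sum_congr rfl fun y _ => ?_
    rw [char_conj, ← AddChar.map_add_eq_mul, sub_eq_add_neg]
  have : ((∑ γ : AddChar G ℂ, ‖∑ x ∈ X, γ x‖ ^ 2 : ℝ) : ℂ) =
      (((Fintype.card G : ℝ) * X.card : ℝ) : ℂ) := by
    push_cast
    have h' : ∀ γ : AddChar G ℂ, ((‖∑ x ∈ X, γ x‖ : ℂ) ^ 2) = ∑ x ∈ X, ∑ y ∈ X, γ (x - y) := by
      intro γ; rw [← h γ]; push_cast; rfl
    simp only [h']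
    rw [Finset.sum_comm]
    have : ∀ x ∈ X, ∑ γ : AddChar G ℂ, ∑ y ∈ X, γ (x - y) = Fintype.card G := by
      intro x hx
      rw [Finset.sum_comm]
      simp only [AddChar.sum_apply_eq_ite, sub_eq_zero]
      rw [Finset.sum_ite_eq]
      simp [hx]
    rw [Finset.sum_congr rfl this]
    simp [mul_comm]
  exact_mod_cast this

/-- Fourier coefficients of hfun -/
def hcoef (Q A1 A2 : Finset G) (γ : AddChar G ℂ) : ℂ :=
  (∑ q ∈ Q, γ (-q)) * cavg A1 γ * cavg A2 γ / Fintype.card G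

lemma ind_fourier (Q : Finset G) (v : G) :
    ((ind Q v : ℝ) : ℂ) = (∑ γ : AddChar G ℂ, (∑ q ∈ Q, γ (-q)) * γ v) / Fintype.card G := by
  have hN : (Fintype.card G : ℂ) ≠ 0 := by
    exact_mod_cast Fintype.card_ne_zero
  have : ∑ γ : AddChar G ℂ, (∑ q ∈ Q, γ (-q)) * γ v = ∑ q ∈ Q, ∑ γ : AddChar G ℂ, γ (v - q) := by
    rw [Finset.sum_comm]
    refine Finset.sum_congr rfl fun γ _ => ?_
    rw [Finset.sum_mul]
    refine Finset.sum_congr rfl fun q _ => ?_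
    rw [← AddChar.map_add_eq_mul]; congr 1; abel
  rw [this]
  simp only [AddChar.sum_apply_eq_ite, sub_eq_zero]
  rw [Finset.sum_ite_eq]
  unfold ind
  split_ifs <;> simp [hN]

lemma hfun_fourier (Q A1 A2 : Finset G) (u : G) :
    ((hfun Q A1 A2 u : ℝ) : ℂ) = ∑ γ : AddChar G ℂ, hcoef Q A1 A2 γ * γ u := by
  unfold hfun gfun
  push_cast
  simp only [ind_fourier]
  simp only [← Finset.sum_div]
  have : ∑ i ∈ A1, ∑ a ∈ A2, ∑ γ : AddChar G ℂ, (∑ q ∈ Q, γ (-q)) * γ (i + u + a) =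
      ∑ γ : AddChar G ℂ, (∑ q ∈ Q, γ (-q)) * (∑ a ∈ A1, γ a) * (∑ a ∈ A2, γ a) * γ u := by
    have h1 : ∀ i ∈ A1, ∑ a ∈ A2, ∑ γ : AddChar G ℂ, (∑ q ∈ Q, γ (-q)) * γ (i + u + a) =
        ∑ γ : AddChar G ℂ, ∑ a ∈ A2, (∑ q ∈ Q, γ (-q)) * γ (i + u + a) :=
      fun i _ => Finset.sum_comm
    rw [Finset.sum_congr rfl h1, Finset.sum_comm]
    refine Finset.sum_congr rfl fun γ _ => ?_
    rw [mul_assoc (∑ q ∈ Q, γ (-q)), Finset.sum_mul_sum]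
    simp only [Finset.mul_sum, Finset.sum_mul, AddChar.map_add_eq_mul]
    refine Finset.sum_congr rfl fun i _ => Finset.sum_congr rfl fun a _ =>
      Finset.sum_congr rfl fun q _ => ?_
    ring
  rw [this]
  rw [Finset.sum_div, Finset.sum_div, Finset.sum_div]
  refine Finset.sum_congr rfl fun γ _ => ?_
  unfold hcoef cavg
  ring

lemma cavg_norm_le (T : Finset G) (γ : AddChar G ℂ) : ‖cavg T γ‖ ≤ 1 := by
  unfold cavg
  rw [norm_div, Complex.norm_natCast]
  refine div_le_one_of_le₀ ?_ (Nat.cast_nonneg _)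
  refine (norm_sum_le _ _).trans ?_
  simp [norm_char]

lemma hcoef_sum (Q A1 A2 : Finset G) (h1 : A1.Nonempty) :
    ∑ γ : AddChar G ℂ, ‖hcoef Q A1 A2 γ‖ ≤ Real.sqrt (Q.card / A1.card) := by
  have hN : (0 : ℝ) < Fintype.card G := by exact_mod_cast Fintype.card_pos
  have hA : (0 : ℝ) < A1.card := by exact_mod_cast h1.card_pos
  refine Real.le_sqrt_of_sq_le ?_
  have hb : ∑ γ : AddChar G ℂ, ‖hcoef Q A1 A2 γ‖ ≤
      (∑ γ : AddChar G ℂ, ‖∑ x ∈ Q, γ x‖ * ‖∑ x ∈ A1, γ x‖) / (A1.card * Fintype.card G) := by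
    rw [Finset.sum_div]
    refine Finset.sum_le_sum fun γ _ => ?_
    unfold hcoef
    rw [norm_div, norm_mul, norm_mul, sum_neg_norm, Complex.norm_natCast]
    have : ‖cavg A1 γ‖ = ‖∑ x ∈ A1, γ x‖ / A1.card := by
      unfold cavg; rw [norm_div, Complex.norm_natCast]
    rw [this]
    calc _ ≤ ‖∑ x ∈ Q, γ x‖ * (‖∑ x ∈ A1, γ x‖ / A1.card) * 1 / Fintype.card G := by
          gcongr; exact cavg_norm_le _ _
      _ = _ := by field_simp
  have hcs := Finset.sum_mul_sq_le_sq_mul_sq (Finset.univ : Finset (AddChar G ℂ))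
    (fun γ => ‖∑ x ∈ Q, γ x‖) (fun γ => ‖∑ x ∈ A1, γ x‖)
  rw [parseval, parseval] at hcs
  calc (∑ γ : AddChar G ℂ, ‖hcoef Q A1 A2 γ‖) ^ 2
      ≤ ((∑ γ : AddChar G ℂ, ‖∑ x ∈ Q, γ x‖ * ‖∑ x ∈ A1, γ x‖) /
          (A1.card * Fintype.card G)) ^ 2 := by gcongr
    _ ≤ ((Fintype.card G : ℝ) * Q.card * (Fintype.card G * A1.card)) /
          ((A1.card : ℝ) * Fintype.card G) ^ 2 := by
        rw [div_pow]; gcongr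
    _ = _ := by field_simp

/-- averaging operator -/
def Mop (T : Finset G) (f : G → ℂ) (u : G) : ℂ :=
  (∑ s ∈ T, ∑ s' ∈ T, f (u + s - s')) / (T.card : ℂ) ^ 2

lemma Mop_fourier (T : Finset G) (c : AddChar G ℂ → ℂ) :
    Mop T (fun u => ∑ γ, c γ * γ u) = fun u => ∑ γ, (c γ * (‖cavg T γ‖ : ℂ) ^ 2) * γ u := by
  funext u
  unfold Mop
  have h1 : ∑ s ∈ T, ∑ s' ∈ T, ∑ γ : AddChar G ℂ, c γ * γ (u + s - s') =
      ∑ γ : AddChar G ℂ, c γ * ((∑ s ∈ T, γ s) * (∑ s ∈ T, γ (-s))) * γ u := by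
    have h1 : ∀ i ∈ T, ∑ a ∈ T, ∑ γ : AddChar G ℂ, c γ * γ (u + i - a) =
        ∑ γ : AddChar G ℂ, ∑ a ∈ T, c γ * γ (u + i - a) :=
      fun i _ => Finset.sum_comm
    rw [Finset.sum_congr rfl h1, Finset.sum_comm]
    refine Finset.sum_congr rfl fun γ _ => ?_
    rw [Finset.sum_mul_sum]
    simp only [Finset.mul_sum, Finset.sum_mul, AddChar.map_add_eq_mul, sub_eq_add_neg]
    refine Finset.sum_congr rfl fun i _ => Finset.sum_congr rfl fun a _ => ?_
    ring
  rw [h1, Finset.sum_div]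
  refine Finset.sum_congr rfl fun γ _ => ?_
  have h2 : ∑ s ∈ T, γ (-s) = (starRingEnd ℂ) (∑ s ∈ T, γ s) := by
    rw [map_sum]; simp only [char_conj]
  rw [h2, Complex.mul_conj']
  unfold cavg
  rw [norm_div, Complex.norm_natCast]
  push_cast
  ring

lemma Mop_iter_fourier (T : Finset G) (c : AddChar G ℂ → ℂ) (m : ℕ) :
    (Mop T)^[m] (fun u => ∑ γ, c γ * γ u) =
      fun u => ∑ γ, (c γ * (‖cavg T γ‖ : ℂ) ^ (2 * m)) * γ u := by
  induction m with
  | zero => simp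
  | succ m ih =>
    rw [Function.iterate_succ_apply', ih, Mop_fourier]
    funext u
    refine Finset.sum_congr rfl fun γ _ => ?_
    ring

lemma Mop_contr (T : Finset G) (f g : G → ℂ) (η : ℝ) (hη : 0 ≤ η) (h : ∀ u, ‖f u - g u‖ ≤ η) (u : G) :
    ‖Mop T f u - Mop T g u‖ ≤ η := by
  unfold Mop
  rw [← sub_div, ← Finset.sum_sub_distrib, norm_div, norm_pow, Complex.norm_natCast]
  refine div_le_of_le_mul₀ (by positivity) hη ?_
  calc _ ≤ ∑ s ∈ T, ∑ s' ∈ T, η := by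
        refine (norm_sum_le _ _).trans (Finset.sum_le_sum fun s _ => ?_)
        rw [← Finset.sum_sub_distrib]
        exact (norm_sum_le _ _).trans (Finset.sum_le_sum fun s' _ => h _)
    _ = _ := by simp; ring

lemma Mop_near (T : Finset G) (hT : T.Nonempty) (f : G → ℂ) (η : ℝ) (hη : 0 ≤ η)
    (h : ∀ s ∈ T, ∀ s' ∈ T, ∀ u, ‖f (u + s) - f (u + s')‖ ≤ η) (u : G) :
    ‖Mop T f u - f u‖ ≤ η := by
  have hT0 : (T.card : ℂ) ≠ 0 := by exact_mod_cast hT.card_pos.ne'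
  unfold Mop
  have e : f u = (∑ s ∈ T, ∑ s' ∈ T, f u) / (T.card : ℂ) ^ 2 := by
    simp; field_simp
  rw [e, ← sub_div, ← Finset.sum_sub_distrib, norm_div, norm_pow, Complex.norm_natCast]
  refine div_le_of_le_mul₀ (by positivity) hη ?_
  calc _ ≤ ∑ s ∈ T, ∑ s' ∈ T, η := by
        refine (norm_sum_le _ _).trans (Finset.sum_le_sum fun s hs => ?_)
        rw [← Finset.sum_sub_distrib]
        refine (norm_sum_le _ _).trans (Finset.sum_le_sum fun s' hs' => ?_)
        have := h s hs s' hs' (u - s')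
        rw [sub_add_cancel] at this
        rw [show u + s - s' = u - s' + s by abel]
        exact this
    _ = _ := by simp; ring

lemma Mop_iter_near (T : Finset G) (hT : T.Nonempty) (f : G → ℂ) (η : ℝ) (hη : 0 ≤ η)
    (h : ∀ s ∈ T, ∀ s' ∈ T, ∀ u, ‖f (u + s) - f (u + s')‖ ≤ η) (m : ℕ) :
    ∀ u, ‖(Mop T)^[m] f u - f u‖ ≤ m * η := by
  induction m with
  | zero => intro u; simp
  | succ m ih =>
    intro u
    rw [Function.iterate_succ_apply']
    have e1 := Mop_contr T _ _ _ (by positivity) ih u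
    have e2 := Mop_near T hT f η hη h u
    calc _ = ‖(Mop T ((Mop T)^[m] f) u - Mop T f u) + (Mop T f u - f u)‖ := by congr 1; ring
      _ ≤ _ := norm_add_le _ _
      _ ≤ m * η + η := add_le_add e1 e2
      _ = _ := by push_cast; ring

lemma smooth (Q A1 A2 T : Finset G) (h1 : A1.Nonempty) (hT : T.Nonempty) (θ δ : ℝ) (hθ : 0 ≤ θ)
    (hδ : 0 ≤ δ) (m : ℕ)
    (hper : ∀ s ∈ T, ∀ s' ∈ T, ∀ u, |hfun Q A1 A2 (u + s) - hfun Q A1 A2 (u + s')| ≤ 2 * θ)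
    (x : G) (hx : ∀ γ : AddChar G ℂ, 1 / 2 ≤ ‖cavg T γ‖ → ‖γ x - 1‖ ≤ δ) (u : G) :
    |hfun Q A1 A2 (u + x) - hfun Q A1 A2 u| ≤
      4 * θ * m + (2 * (1 / 4) ^ m + δ) * Real.sqrt (Q.card / A1.card) := by
  set f : G → ℂ := fun u => ((hfun Q A1 A2 u : ℝ) : ℂ) with hf
  have hff : f = fun u => ∑ γ : AddChar G ℂ, hcoef Q A1 A2 γ * γ u := by
    funext u; exact hfun_fourier Q A1 A2 u
  have hnear := Mop_iter_near T hT f (2 * θ) (by positivity) (by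
    intro s hs s' hs' u
    simp only [hf]
    rw [← Complex.ofReal_sub, Complex.norm_real]
    exact hper s hs s' hs' u) m
  have hH : ∀ u, (Mop T)^[m] f u = ∑ γ, (hcoef Q A1 A2 γ * (‖cavg T γ‖ : ℂ) ^ (2 * m)) * γ u := by
    intro u; rw [hff, Mop_iter_fourier]
  have hdiff : ‖(Mop T)^[m] f (u + x) - (Mop T)^[m] f u‖ ≤
      (2 * (1 / 4) ^ m + δ) * Real.sqrt (Q.card / A1.card) := by
    rw [hH, hH, ← Finset.sum_sub_distrib]
    refine (norm_sum_le _ _).trans ?_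
    calc _ ≤ ∑ γ : AddChar G ℂ, ‖hcoef Q A1 A2 γ‖ * (2 * (1 / 4) ^ m + δ) := by
          refine Finset.sum_le_sum fun γ _ => ?_
          have e : hcoef Q A1 A2 γ * (‖cavg T γ‖ : ℂ) ^ (2 * m) * γ (u + x) -
              hcoef Q A1 A2 γ * (‖cavg T γ‖ : ℂ) ^ (2 * m) * γ u =
              hcoef Q A1 A2 γ * ((‖cavg T γ‖ : ℂ) ^ (2 * m) * (γ x - 1)) * γ u := by
            rw [AddChar.map_add_eq_mul]; ring
          rw [e, norm_mul, norm_mul, norm_char, mul_one]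
          gcongr
          rw [norm_mul, norm_pow, Complex.norm_real, Real.norm_of_nonneg (norm_nonneg _)]
          rcases le_or_gt (1 / 2) ‖cavg T γ‖ with hc | hc
          · have := hx γ hc
            have h3 : ‖cavg T γ‖ ^ (2 * m) ≤ 1 := pow_le_one₀ (norm_nonneg _) (cavg_norm_le _ _)
            have h4 : (0 : ℝ) ≤ 2 * (1 / 4) ^ m := by positivity
            nlinarith [norm_nonneg (γ x - 1)]
          · have h3 : ‖cavg T γ‖ ^ (2 * m) ≤ (1 / 4) ^ m := by
              rw [pow_mul]
              gcongr
              nlinarith [norm_nonneg (cavg T γ)]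
            have h5 : ‖γ x - 1‖ ≤ 2 := by
              refine (norm_sub_le _ _).trans ?_
              rw [norm_char, norm_one]; norm_num
            have : ‖cavg T γ‖ ^ (2 * m) * ‖γ x - 1‖ ≤ (1 / 4) ^ m * 2 := by gcongr
            linarith
      _ = (2 * (1 / 4) ^ m + δ) * ∑ γ : AddChar G ℂ, ‖hcoef Q A1 A2 γ‖ := by
          rw [← Finset.sum_mul, mul_comm]
      _ ≤ _ := by
          gcongr
          exact hcoef_sum Q A1 A2 h1
  have e1 := hnear (u + x)
  have e2 := hnear u
  have e3 : |hfun Q A1 A2 (u + x) - hfun Q A1 A2 u| = ‖f (u + x) - f u‖ := by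
    simp only [hf]; rw [← Complex.ofReal_sub, Complex.norm_real, Real.norm_eq_abs]
  rw [e3]
  have e4 : f (u + x) - f u = -((Mop T)^[m] f (u + x) - f (u + x)) +
      ((Mop T)^[m] f (u + x) - (Mop T)^[m] f u) + ((Mop T)^[m] f u - f u) := by ring
  rw [e4]
  refine (norm_add₃_le).trans ?_
  rw [norm_neg]
  linarith

end fourier
end SSix

namespace SSix

section chang
variable {G : Type} [AddCommGroup G] [Fintype G] [DecidableEq G]

/-- span with coefficients in minus one, zero, one -/
def sp : List (AddChar G ℂ) → Set (AddChar G ℂ)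
  | [] => {1}
  | γ :: l => {χ | χ ∈ sp l ∨ (∃ ψ ∈ sp l, χ = γ * ψ) ∨ (∃ ψ ∈ sp l, χ = γ⁻¹ * ψ)}

/-- dissociativity relative to a set -/
def Dis (B : Finset G) : List (AddChar G ℂ) → Prop
  | [] => True
  | γ :: l => Dis B l ∧ ∀ ψ ∈ sp l, ‖cavg B (γ * ψ)‖ ≤ 1 / 2 ∧ ‖cavg B (γ⁻¹ * ψ)‖ ≤ 1 / 2

/-- Riesz product -/
def Fr (c : AddChar G ℂ → ℂ) : List (AddChar G ℂ) → G → ℝ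
  | [], _ => 1
  | γ :: l, x => (Real.cosh (1/2) + (c γ * γ x).re * Real.sinh (1/2)) * Fr c l x

lemma re_formula (γ : AddChar G ℂ) (c : ℂ) (x : G) :
    (((c * γ x).re : ℝ) : ℂ) = c / 2 * γ x + (starRingEnd ℂ) c / 2 * γ⁻¹ x := by
  rw [AddChar.inv_apply, ← char_conj]
  have := Complex.re_eq_add_conj (c * γ x)
  rw [this, map_mul]; ring

lemma sinh_half_nonneg : 0 ≤ Real.sinh (1/2) := Real.sinh_nonneg_iff.2 (by norm_num)

lemma Fr_step (c : AddChar G ℂ → ℂ) (γ : AddChar G ℂ) (l) (χ : AddChar G ℂ)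
    (L : (G → ℂ) →ₗ[ℂ] ℂ) :
    L (fun x => χ x * (Fr c (γ :: l) x : ℂ)) =
      Real.cosh (1/2) * L (fun x => χ x * (Fr c l x : ℂ)) +
      (Real.sinh (1/2) * (c γ / 2)) * L (fun x => (γ * χ) x * (Fr c l x : ℂ)) +
      (Real.sinh (1/2) * ((starRingEnd ℂ) (c γ) / 2)) * L (fun x => (γ⁻¹ * χ) x * (Fr c l x : ℂ)) := by
  have e : (fun x => χ x * (Fr c (γ :: l) x : ℂ)) =
      (Real.cosh (1/2) : ℂ) • (fun x => χ x * (Fr c l x : ℂ)) +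
      (Real.sinh (1/2) * (c γ / 2)) • (fun x => (γ * χ) x * (Fr c l x : ℂ)) +
      (Real.sinh (1/2) * ((starRingEnd ℂ) (c γ) / 2)) • (fun x => (γ⁻¹ * χ) x * (Fr c l x : ℂ)) := by
    funext x
    simp only [Pi.add_apply, Pi.smul_apply, smul_eq_mul, Fr, AddChar.mul_apply]
    rw [Complex.ofReal_mul, Complex.ofReal_add, Complex.ofReal_mul, re_formula]
    ring
  rw [e, map_add, map_add, map_smul, map_smul, map_smul]
  rfl

lemma Fr_step_norm (c : AddChar G ℂ → ℂ) (hc : ∀ γ, ‖c γ‖ = 1) (γ : AddChar G ℂ) (l)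
    (χ : AddChar G ℂ) (L : (G → ℂ) →ₗ[ℂ] ℂ) (a b : ℝ)
    (h1 : ‖L (fun x => χ x * (Fr c l x : ℂ))‖ ≤ a)
    (h2 : ‖L (fun x => (γ * χ) x * (Fr c l x : ℂ))‖ ≤ b)
    (h3 : ‖L (fun x => (γ⁻¹ * χ) x * (Fr c l x : ℂ))‖ ≤ b) :
    ‖L (fun x => χ x * (Fr c (γ :: l) x : ℂ))‖ ≤ Real.cosh (1/2) * a + Real.sinh (1/2) * b := by
  rw [Fr_step]
  have hs := sinh_half_nonneg
  have hch := (Real.cosh_pos (1/2)).le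
  refine norm_add₃_le.trans ?_
  rw [norm_mul, norm_mul, norm_mul, norm_mul, norm_mul, Complex.norm_real, Complex.norm_real,
    norm_div, norm_div, RCLike.norm_conj, hc, Real.norm_of_nonneg hs, Real.norm_of_nonneg hch]
  have : ‖(2:ℂ)‖ = 2 := by norm_num
  rw [this]
  have e1 : Real.cosh (1/2) * ‖L (fun x => χ x * (Fr c l x : ℂ))‖ ≤ Real.cosh (1/2) * a := by gcongr
  have e2 : Real.sinh (1/2) * (1/2) * ‖L (fun x => (γ * χ) x * (Fr c l x : ℂ))‖ ≤
    Real.sinh (1/2) * (1/2) * b := by gcongr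
  have e3 : Real.sinh (1/2) * (1/2) * ‖L (fun x => (γ⁻¹ * χ) x * (Fr c l x : ℂ))‖ ≤
    Real.sinh (1/2) * (1/2) * b := by gcongr
  linarith

lemma riesz_B (c : AddChar G ℂ → ℂ) (hc : ∀ γ, ‖c γ‖ = 1) (L : (G → ℂ) →ₗ[ℂ] ℂ) (η : ℝ)
    (l : List (AddChar G ℂ)) : ∀ χ : AddChar G ℂ,
    (∀ ψ ∈ sp l, ‖L (fun x => (χ * ψ) x)‖ ≤ η) →
    ‖L (fun x => χ x * (Fr c l x : ℂ))‖ ≤ Real.exp (1/2) ^ l.length * η := by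
  induction l with
  | nil =>
    intro χ h
    have := h 1 (by simp [sp])
    simpa [Fr] using this
  | cons γ l ih =>
    intro χ h
    refine (Fr_step_norm c hc γ l χ L _ _ (ih χ ?_) (ih (γ * χ) ?_) (ih (γ⁻¹ * χ) ?_)).trans ?_
    · intro ψ hψ; exact h ψ (Or.inl hψ)
    · intro ψ hψ
      rw [show γ * χ * ψ = χ * (γ * ψ) by rw [mul_comm γ χ, mul_assoc]]
      exact h _ (Or.inr (Or.inl ⟨ψ, hψ, rfl⟩))
    · intro ψ hψ
      rw [show γ⁻¹ * χ * ψ = χ * (γ⁻¹ * ψ) by rw [mul_comm γ⁻¹ χ, mul_assoc]]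
      exact h _ (Or.inr (Or.inr ⟨ψ, hψ, rfl⟩))
    · rw [List.length_cons, pow_succ, ← Real.cosh_add_sinh (1/2)]
      apply le_of_eq; ring

lemma riesz_C (B : Finset G) (c : AddChar G ℂ → ℂ) (hc : ∀ γ, ‖c γ‖ = 1) (L : (G → ℂ) →ₗ[ℂ] ℂ)
    (η : ℝ) (hη : 0 ≤ η) (h0 : ‖L (fun _ => 1)‖ ≤ 1)
    (hL : ∀ χ : AddChar G ℂ, ‖cavg B χ‖ ≤ 1 / 2 → ‖L (fun x => χ x)‖ ≤ η)
    (l : List (AddChar G ℂ)) (hd : Dis B l) :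
    ‖L (fun x => (Fr c l x : ℂ))‖ ≤
      Real.cosh (1/2) ^ l.length + (Real.exp (1/2) ^ l.length - Real.cosh (1/2) ^ l.length) * η := by
  induction l with
  | nil => simpa [Fr] using h0
  | cons γ l ih =>
    obtain ⟨hd1, hd2⟩ := hd
    have key := Fr_step_norm c hc γ l 1 L _ (Real.exp (1/2) ^ l.length * η)
      (by simpa only [AddChar.one_apply, one_mul] using ih hd1)
      (by
        rw [mul_one]
        exact riesz_B c hc L η l γ fun ψ hψ => hL _ (hd2 ψ hψ).1)
      (by
        rw [mul_one]
        exact riesz_B c hc L η l γ⁻¹ fun ψ hψ => hL _ (hd2 ψ hψ).2)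
    simp only [AddChar.one_apply, one_mul] at key
    refine key.trans (le_of_eq ?_)
    rw [List.length_cons, pow_succ, pow_succ]
    have e := Real.cosh_add_sinh (1/2)
    generalize Real.exp (1/2) ^ l.length = E at *
    rw [← e]
    ring

lemma Fr_lower (c : AddChar G ℂ → ℂ) (hc : ∀ γ, ‖c γ‖ = 1) (l : List (AddChar G ℂ)) (x : G) :
    Real.exp (1/2 * (l.map (fun γ => (c γ * γ x).re)).sum) ≤ Fr c l x := by
  induction l with
  | nil => simp [Fr]
  | cons γ l ih =>
    have hn : |(c γ * γ x).re| ≤ 1 := by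
      refine (Complex.abs_re_le_norm _).trans ?_
      rw [norm_mul, hc, norm_char, one_mul]
    rw [abs_le] at hn
    have := exp_mul_le_cosh (1/2) _ hn.1 hn.2
    rw [List.map_cons, List.sum_cons, mul_add, Real.exp_add]
    unfold Fr
    exact mul_le_mul this ih (Real.exp_pos _).le ((Real.exp_pos _).le.trans this)

lemma Fr_nonneg (c : AddChar G ℂ → ℂ) (hc : ∀ γ, ‖c γ‖ = 1) (l : List (AddChar G ℂ)) (x : G) :
    0 ≤ Fr c l x := (Real.exp_pos _).le.trans (Fr_lower c hc l x)

/-- averaging over B -/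
def Pav (B : Finset G) : (G → ℂ) →ₗ[ℂ] (G → ℂ) where
  toFun f x := (∑ b ∈ B, f (x + b)) / B.card
  map_add' f g := by
    funext x; simp [Finset.sum_add_distrib, add_div]
  map_smul' a f := by
    funext x; simp [← Finset.mul_sum, mul_div_assoc]

lemma Pav_char (B : Finset G) (χ : AddChar G ℂ) (m : ℕ) :
    ((Pav B) ^ m) (fun x => χ x) = fun x => cavg B χ ^ m * χ x := by
  induction m with
  | zero => simp
  | succ m ih =>
    rw [pow_succ', Module.End.mul_apply, ih]
    funext x
    simp only [Pav, LinearMap.coe_mk, AddHom.coe_mk, AddChar.map_add_eq_mul]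
    rw [pow_succ]
    rw [Finset.sum_congr rfl (fun b _ => show cavg B χ ^ m * (χ x * χ b) =
      (cavg B χ ^ m * χ x) * χ b by ring), ← Finset.mul_sum]
    generalize hE : cavg B χ ^ m = E
    unfold cavg
    ring

lemma Pav_pos (Γ : Finset (AddChar G ℂ)) (ρ r : ℝ) (hr : 0 ≤ r)
    (f : G → ℝ) (hf : ∀ x, 0 ≤ f x) (m : ℕ) :
    ∃ g : G → ℝ, (∀ x, 0 ≤ g x) ∧ ((Pav (bohr Γ r)) ^ m) (fun x => (f x : ℂ)) = (fun x => (g x : ℂ)) ∧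
      ∑ x ∈ bohr Γ ρ, f x ≤ ∑ x ∈ bohr Γ (ρ + m * r), g x := by
  induction m with
  | zero => exact ⟨f, hf, by simp, by simp⟩
  | succ m ih =>
    obtain ⟨g, hg, h1, h2⟩ := ih
    have hB : (0:ℝ) < (bohr Γ r).card := by exact_mod_cast bohr_card_pos (Γ := Γ) hr
    refine ⟨fun x => (∑ b ∈ bohr Γ r, g (x + b)) / (bohr Γ r).card, fun x => ?_, ?_, ?_⟩
    · exact div_nonneg (Finset.sum_nonneg fun b _ => hg _) hB.le
    · rw [pow_succ', Module.End.mul_apply, h1]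
      funext x
      simp [Pav]
    · refine h2.trans ?_
      rw [← Finset.sum_div, Finset.sum_comm, le_div_iff₀ hB, mul_comm, ← nsmul_eq_mul,
        ← Finset.sum_const]
      refine Finset.sum_le_sum fun b hb => ?_
      rw [← Finset.sum_image (s := bohr Γ (ρ + (m+1:ℕ) * r)) (g := fun x => x + b) (f := g)
        (fun x _ y _ h => add_right_cancel h)]
      refine Finset.sum_le_sum_of_subset_of_nonneg ?_ fun _ _ _ => hg _
      intro z hz
      rw [Finset.mem_image]
      refine ⟨z - b, ?_, by abel⟩
      have := sub_mem_bohr hz hb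
      refine bohr_mono ?_ this
      push_cast; linarith

lemma chang_bound (Γ : Finset (AddChar G ℂ)) (ρ r : ℝ) (hρ : 0 ≤ ρ) (hr : 0 ≤ r) (m : ℕ)
    (hreg : ((bohr Γ (ρ + m * r)).card : ℝ) ≤ 2 * (bohr Γ ρ).card)
    (T : Finset G) (hT : T ⊆ bohr Γ ρ) (hTn : T.Nonempty) (τ : ℝ) (hτ : 0 < τ)
    (hTc : τ * (bohr Γ ρ).card ≤ T.card)
    (l : List (AddChar G ℂ)) (hl : ∀ γ ∈ l, 1 / 2 ≤ ‖cavg T γ‖) (hd : Dis (bohr Γ r) l)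
    (hlen : l.length ≤ m) : Real.exp (l.length / 8) ≤ 4 / τ := by
  have hT0 : (0:ℝ) < T.card := by exact_mod_cast hTn.card_pos
  have hB : (0:ℝ) < (bohr Γ ρ).card := by exact_mod_cast bohr_card_pos (Γ := Γ) hρ
  have hBm : (0:ℝ) < (bohr Γ (ρ + m * r)).card := by
    exact_mod_cast bohr_card_pos (Γ := Γ) (by positivity)
  -- phases
  have hph : ∀ γ : AddChar G ℂ, ∃ c : ℂ, ‖c‖ = 1 ∧ c * cavg T γ = (‖cavg T γ‖ : ℂ) := by
    intro γ
    by_cases h : cavg T γ = 0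
    · exact ⟨1, by simp, by simp [h]⟩
    · have hn : (‖cavg T γ‖ : ℂ) ≠ 0 := by exact_mod_cast norm_ne_zero_iff.2 h
      refine ⟨(starRingEnd ℂ) (cavg T γ) / ‖cavg T γ‖, ?_, ?_⟩
      · rw [norm_div, RCLike.norm_conj, Complex.norm_real, norm_norm, div_self]
        exact norm_ne_zero_iff.2 h
      · rw [div_mul_eq_mul_div, Complex.conj_mul']
        field_simp
  choose c hc hc2 using hph
  set n := l.length with hn
  -- lower bound
  have hZ : ∀ l' : List (AddChar G ℂ), (∀ γ ∈ l', 1 / 2 ≤ ‖cavg T γ‖) →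
      (T.card : ℝ) * (l'.length / 2) ≤ ∑ t ∈ T, (l'.map (fun γ => (c γ * γ t).re)).sum := by
    intro l'
    induction l' with
    | nil => intro _; simp
    | cons γ l' ih =>
      intro h
      have h1 := ih fun γ' h' => h γ' (List.mem_cons_of_mem _ h')
      have h2 := h γ List.mem_cons_self
      simp only [List.map_cons, List.sum_cons, List.length_cons]
      rw [Finset.sum_add_distrib]
      have h3 : ∑ t ∈ T, (c γ * γ t).re = T.card * ‖cavg T γ‖ := by
        rw [← Complex.re_sum, ← Finset.mul_sum]
        have : ∑ t ∈ T, γ t = T.card * cavg T γ := by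
          have : (T.card : ℂ) ≠ 0 := by exact_mod_cast hT0.ne'
          unfold cavg; field_simp
        rw [this, mul_left_comm, hc2, ← Complex.ofReal_natCast, ← Complex.ofReal_mul,
          Complex.ofReal_re]
      rw [h3]
      push_cast
      have : (T.card:ℝ) * (1/2) ≤ T.card * ‖cavg T γ‖ := by gcongr
      linarith
  have hlow : (T.card : ℝ) * Real.exp (n / 4) ≤ ∑ t ∈ T, Fr c l t := by
    have h1 : ∀ t ∈ T, Real.exp (n/4) * (1 + (1/2 * (l.map (fun γ => (c γ * γ t).re)).sum - n/4)) ≤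
        Fr c l t := by
      intro t _
      refine le_trans ?_ (Fr_lower c hc l t)
      have := Real.add_one_le_exp (1/2 * (l.map (fun γ => (c γ * γ t).re)).sum - n/4)
      calc _ ≤ Real.exp (n/4) * Real.exp (1/2 * (l.map (fun γ => (c γ * γ t).re)).sum - n/4) := by
            gcongr; linarith
        _ = _ := by rw [← Real.exp_add]; congr 1; ring
    refine le_trans ?_ (Finset.sum_le_sum h1)
    rw [← Finset.mul_sum, Finset.sum_add_distrib, Finset.sum_sub_distrib, ← Finset.mul_sum, mul_comm]
    gcongr
    have := hZ l hl
    simp only [Finset.sum_const, nsmul_eq_mul]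
    rw [← hn] at this
    linarith
  -- upper bound
  obtain ⟨g, hg0, hg1, hg2⟩ := Pav_pos Γ ρ r hr (Fr c l) (Fr_nonneg c hc l) m
  let S := bohr Γ (ρ + m * r)
  let L : (G → ℂ) →ₗ[ℂ] ℂ :=
    { toFun := fun f => (∑ x ∈ S, ((Pav (bohr Γ r)) ^ m) f x) / S.card
      map_add' := by intro f g; simp [Finset.sum_add_distrib, add_div]
      map_smul' := by intro a f; simp [← Finset.mul_sum, mul_div_assoc] }
  have hLχ : ∀ χ : AddChar G ℂ, L (fun x => χ x) = cavg (bohr Γ r) χ ^ m * cavg S χ := by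
    intro χ
    change (∑ x ∈ S, ((Pav (bohr Γ r)) ^ m) (fun x => χ x) x) / (S.card : ℂ) = _
    rw [Pav_char, ← Finset.mul_sum, mul_div_assoc]; rfl
  have hLF : L (fun x => (Fr c l x : ℂ)) = (((∑ x ∈ S, g x) / S.card : ℝ) : ℂ) := by
    change (∑ x ∈ S, ((Pav (bohr Γ r)) ^ m) (fun x => (Fr c l x : ℂ)) x) / (S.card : ℂ) = _
    rw [hg1]; push_cast; rfl
  have hup := riesz_C (bohr Γ r) c hc L ((1/2) ^ m) (by positivity) (by
      have := hLχ 1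
      simp only [AddChar.one_apply] at this
      rw [this, norm_mul, norm_pow]
      exact mul_le_one₀ (pow_le_one₀ (norm_nonneg _) (cavg_norm_le _ _)) (norm_nonneg _)
        (cavg_norm_le _ _)) (by
      intro χ h
      rw [hLχ, norm_mul, norm_pow]
      calc _ ≤ (1/2 : ℝ) ^ m * 1 := by
            gcongr; exact cavg_norm_le _ _
        _ = _ := mul_one _) l hd
  rw [hLF, Complex.norm_real, ← hn] at hup
  have hup2 : (∑ x ∈ S, g x) / S.card ≤ 2 * Real.exp (n / 8) := by
    refine (Real.le_norm_self _).trans (hup.trans ?_)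
    have e1 : Real.cosh (1/2) ^ n ≤ Real.exp (n/8) := by
      calc _ ≤ Real.exp ((1/2)^2/2) ^ n := by
            have := (Real.cosh_pos (1/2)).le
            gcongr; exact Real.cosh_le_exp_half_sq _
        _ = _ := by rw [← Real.exp_nat_mul]; congr 1; ring
    have e2 : Real.exp (1/2) ^ n * (1/2) ^ m ≤ 1 := by
      have h5 : Real.exp (1/2) ≤ 2 := by
        have h6 : Real.exp (1/2) * Real.exp (1/2) = Real.exp 1 := by rw [← Real.exp_add]; norm_num
        have := Real.exp_one_lt_d9
        nlinarith [Real.exp_pos (1/2)]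
      calc _ ≤ (2:ℝ)^m * (1/2)^m := by
            gcongr
            calc Real.exp (1/2) ^ n ≤ 2 ^ n := by gcongr
              _ ≤ 2 ^ m := by gcongr; norm_num
        _ = 1 := by rw [← mul_pow]; norm_num
    have e3 : (1:ℝ) ≤ Real.exp (n/8) := Real.one_le_exp (by positivity)
    have e4 : 0 ≤ Real.cosh (1/2) ^ n * (1/2) ^ m := by
      have := (Real.cosh_pos (1/2)).le
      positivity
    linarith
  rw [div_le_iff₀ hBm] at hup2
  have h7 : ∑ t ∈ T, Fr c l t ≤ ∑ x ∈ bohr Γ ρ, Fr c l x :=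
    Finset.sum_le_sum_of_subset_of_nonneg hT fun _ _ _ => Fr_nonneg c hc l _
  have h8 : (T.card : ℝ) * Real.exp (n / 4) ≤ 4 * Real.exp (n/8) * (bohr Γ ρ).card := by
    have : 2 * Real.exp (n/8) * S.card ≤ 2 * Real.exp (n/8) * (2 * (bohr Γ ρ).card) := by gcongr
    linarith
  have h9 : Real.exp ((n:ℝ)/4) = Real.exp (n/8) * Real.exp (n/8) := by
    rw [← Real.exp_add]; congr 1; ring
  have h10 : τ * (bohr Γ ρ).card * Real.exp (n/4) ≤ T.card * Real.exp (n/4) := by gcongr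
  have h11 : (τ * Real.exp (n/8)) * (Real.exp (n/8) * (bohr Γ ρ).card) ≤
      4 * (Real.exp (n/8) * (bohr Γ ρ).card) := by
    rw [h9] at h10 h8; linarith
  rw [le_div_iff₀ hτ, mul_comm]
  exact le_of_mul_le_mul_right h11 (by positivity)

lemma cavg_shift (Γ : Finset (AddChar G ℂ)) (r r' c : ℝ) (hr : 0 ≤ r) (hr' : 0 ≤ r')
    (hreg : ((bohr Γ (r + r')).card : ℝ) ≤ (1 + c) * (bohr Γ r).card) (ψ : AddChar G ℂ)
    (hψ : 1 / 2 < ‖cavg (bohr Γ r) ψ‖) (x : G) (hx : x ∈ bohr Γ r') : ‖ψ x - 1‖ ≤ 4 * c := by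
  set B := bohr Γ r with hBdef
  set B' := bohr Γ (r + r') with hB'def
  have hB : (0:ℝ) < B.card := by exact_mod_cast bohr_card_pos (Γ := Γ) hr
  have key : ∀ S : Finset G, S ⊆ B' → S.card = B.card →
      ‖∑ b ∈ B', ψ b - ∑ b ∈ S, ψ b‖ ≤ c * B.card := by
    intro S hS hSc
    rw [← Finset.sum_sdiff hS, add_sub_cancel_right]
    refine (norm_sum_le _ _).trans ?_
    simp only [norm_char, Finset.sum_const, nsmul_eq_mul, mul_one]
    have := Finset.card_sdiff_add_card_eq_card hS
    have h : ((B' \ S).card : ℝ) + S.card = B'.card := by exact_mod_cast this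
    rw [hSc] at h
    linarith
  have h1 := key B (bohr_mono (by linarith)) rfl
  have h2 := key (B.image (fun b => b + x)) (by
    intro z hz
    obtain ⟨b, hb, rfl⟩ := Finset.mem_image.1 hz
    exact add_mem_bohr hb hx) (Finset.card_image_of_injective _ (add_left_injective x))
  rw [Finset.sum_image (fun a _ b _ h => add_right_cancel h)] at h2
  have h3 : ∑ b ∈ B, ψ (b + x) - ∑ b ∈ B, ψ b = B.card * cavg B ψ * (ψ x - 1) := by
    have : ∑ t ∈ B, ψ t = B.card * cavg B ψ := by
      have : (B.card : ℂ) ≠ 0 := by exact_mod_cast hB.ne'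
      unfold cavg; field_simp
    simp only [AddChar.map_add_eq_mul]
    rw [← Finset.sum_mul, this]; ring
  have h4 : ‖∑ b ∈ B, ψ (b + x) - ∑ b ∈ B, ψ b‖ ≤ 2 * c * B.card := by
    have : ∑ b ∈ B, ψ (b + x) - ∑ b ∈ B, ψ b = (∑ b ∈ B', ψ b - ∑ b ∈ B, ψ b) -
      (∑ b ∈ B', ψ b - ∑ b ∈ B, ψ (b + x)) := by ring
    rw [this]
    refine (norm_sub_le _ _).trans ?_
    linarith
  rw [h3, norm_mul, norm_mul, Complex.norm_natCast] at h4
  have h5 : (B.card : ℝ) * (1/2) * ‖ψ x - 1‖ ≤ B.card * ‖cavg B ψ‖ * ‖ψ x - 1‖ := by gcongr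
  have h6 : (B.card : ℝ) * ‖ψ x - 1‖ ≤ B.card * (4 * c) := by linarith
  exact le_of_mul_le_mul_left h6 hB

lemma sp_norm (l : List (AddChar G ℂ)) (η : ℝ) (hη : 0 ≤ η) (x : G) (hx : ∀ γ ∈ l, ‖γ x - 1‖ ≤ η) :
    ∀ χ ∈ sp l, ‖χ x - 1‖ ≤ l.length * η := by
  have hmul : ∀ a b : AddChar G ℂ, ‖(a * b) x - 1‖ ≤ ‖a x - 1‖ + ‖b x - 1‖ := by
    intro a b
    have : (a * b) x - 1 = (a x - 1) * b x + (b x - 1) := by rw [AddChar.mul_apply]; ring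
    rw [this]
    refine (norm_add_le _ _).trans ?_
    rw [norm_mul, norm_char, mul_one]
  have hinv : ∀ a : AddChar G ℂ, ‖a⁻¹ x - 1‖ = ‖a x - 1‖ := by
    intro a; rw [AddChar.inv_apply, char_neg_norm]
  induction l with
  | nil => intro χ h; simp only [sp, Set.mem_singleton_iff] at h; subst h; simp
  | cons γ l ih =>
    have ih' := ih fun γ' h => hx γ' (List.mem_cons_of_mem _ h)
    have h0 := hx γ List.mem_cons_self
    intro χ h
    rw [List.length_cons]
    push_cast
    rcases h with h | ⟨ψ, h, rfl⟩ | ⟨ψ, h, rfl⟩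
    · have := ih' χ h
      linarith
    · have := ih' ψ h
      linarith [hmul γ ψ]
    · have := ih' ψ h
      linarith [hmul γ⁻¹ ψ, hinv γ]

lemma exists_max_dis (T B : Finset G) (m : ℕ) :
    ∀ n ≤ m, (∃ l : List (AddChar G ℂ), (∀ γ ∈ l, 1 / 2 ≤ ‖cavg T γ‖) ∧ Dis B l ∧ l.length = n) ∨
      (∃ l : List (AddChar G ℂ), Dis B l ∧ l.length ≤ m ∧
        ∀ γ, 1 / 2 ≤ ‖cavg T γ‖ → ¬ Dis B (γ :: l)) := by
  intro n
  induction n with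
  | zero => intro _; exact Or.inl ⟨[], by simp, trivial, rfl⟩
  | succ n ih =>
    intro hn
    rcases ih (by omega) with ⟨l, h1, h2, h3⟩ | h
    · by_cases h : ∃ γ, 1 / 2 ≤ ‖cavg T γ‖ ∧ Dis B (γ :: l)
      · obtain ⟨γ, h4, h5⟩ := h
        refine Or.inl ⟨γ :: l, ?_, h5, by simp [h3]⟩
        intro γ' h'
        rcases List.mem_cons.1 h' with rfl | h'
        · exact h4
        · exact h1 _ h'
      · push Not at h
        exact Or.inr ⟨l, h2, by omega, h⟩
    · exact Or.inr h

/-- local Chang theorem -/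
lemma chang (Γ : Finset (AddChar G ℂ)) (ρ r r' c : ℝ) (hρ : 0 ≤ ρ) (hr : 0 ≤ r) (hr' : 0 ≤ r') (m : ℕ)
    (hreg : ((bohr Γ (ρ + m * r)).card : ℝ) ≤ 2 * (bohr Γ ρ).card)
    (hreg' : ((bohr Γ (r + r')).card : ℝ) ≤ (1 + c) * (bohr Γ r).card)
    (T : Finset G) (hT : T ⊆ bohr Γ ρ) (hTn : T.Nonempty) (τ : ℝ) (hτ : 0 < τ)
    (hTc : τ * (bohr Γ ρ).card ≤ T.card) (hm : 8 * Real.log (4 / τ) < m) :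
    ∃ Λ : Finset (AddChar G ℂ), Λ.card ≤ m ∧ ∀ η : ℝ, 0 ≤ η → η ≤ r' → ∀ x ∈ bohr (Γ ∪ Λ) η,
      ∀ γ : AddChar G ℂ, 1 / 2 ≤ ‖cavg T γ‖ → ‖γ x - 1‖ ≤ 4 * c + m * η := by
  classical
  rcases exists_max_dis T (bohr Γ r) m m le_rfl with ⟨l, h1, h2, h3⟩ | ⟨l, h1, h2, h3⟩
  · exfalso
    have := chang_bound Γ ρ r hρ hr m hreg T hT hTn τ hτ hTc l h1 h2 h3.le
    rw [h3, ← Real.le_log_iff_exp_le (by positivity)] at this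
    linarith
  · refine ⟨l.toFinset, (List.toFinset_card_le l).trans h2, ?_⟩
    intro η hη hη' x hx γ hγ
    have hx1 : x ∈ bohr Γ r' := bohr_anti Finset.subset_union_left hη' hx
    have hx2 : ∀ γ' ∈ l, ‖γ' x - 1‖ ≤ η := fun γ' h' =>
      (mem_bohr.1 hx) γ' (Finset.mem_union_right _ (List.mem_toFinset.2 h'))
    have hsp := sp_norm l η hη x hx2
    have hlm : (l.length : ℝ) * η ≤ m * η := by gcongr
    have h4 := h3 γ hγ
    have h5 : ∃ ψ ∈ sp l, 1 / 2 < ‖cavg (bohr Γ r) (γ * ψ)‖ ∨ 1 / 2 < ‖cavg (bohr Γ r) (γ⁻¹ * ψ)‖ := by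
      by_contra hcon
      push Not at hcon
      exact h4 ⟨h1, fun ψ hψ => hcon ψ hψ⟩
    obtain ⟨ψ, hψ, h6⟩ := h5
    have h7 := hsp ψ hψ
    have hfin : ∀ χ : AddChar G ℂ, 1 / 2 < ‖cavg (bohr Γ r) (χ * ψ)‖ → ‖χ x - 1‖ ≤ 4 * c + m * η := by
      intro χ hχ
      have h8 := cavg_shift Γ r r' c hr hr' hreg' _ hχ x hx1
      have e : (χ x - 1) * ψ x = ((χ * ψ) x - 1) - (ψ x - 1) := by rw [AddChar.mul_apply]; ring
      have e2 : ‖χ x - 1‖ = ‖(χ x - 1) * ψ x‖ := by rw [norm_mul, norm_char, mul_one]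
      rw [e2, e]
      refine (norm_sub_le _ _).trans ?_
      linarith
    rcases h6 with h6 | h6
    · exact hfin γ h6
    · have := hfin γ⁻¹ h6
      rwa [AddChar.inv_apply, char_neg_norm] at this

end chang
end SSix

namespace SSix

section stepA
variable {G : Type} [AddCommGroup G] [Fintype G] [DecidableEq G]

/-- portion of A in a translate -/
def loc (A : Finset G) (y : G) (B : Finset G) : Finset G := A.filter (fun a => a - y ∈ B)

lemma mem_loc {A : Finset G} {y : G} {B : Finset G} {a : G} : a ∈ loc A y B ↔ a ∈ A ∧ a - y ∈ B := by
  simp [loc]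

lemma avg_sum (A : Finset G) (Γ : Finset (AddChar G ℂ)) (ρ r r' : ℝ) (x0 : G) (h : r' ≤ r) :
    (loc A x0 (bohr Γ ρ)).card * (bohr Γ r').card ≤
      ∑ b ∈ bohr Γ (ρ + r), (loc A (x0 + b) (bohr Γ r')).card := by
  unfold loc
  simp only [Finset.card_filter]
  rw [Finset.sum_comm, ← Finset.card_filter, ← smul_eq_mul, ← Finset.sum_const]
  refine (Finset.sum_le_sum (fun a ha => ?_)).trans
    (Finset.sum_le_sum_of_subset (Finset.filter_subset _ _))
  rw [← Finset.card_filter]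
  rw [Finset.mem_filter] at ha
  refine Finset.card_le_card_of_injOn (fun t => a - x0 - t) ?_ ?_
  · intro t ht
    have ht' : t ∈ bohr Γ r' := ht
    simp only [Finset.coe_filter, Set.mem_ofPred_eq]
    refine ⟨bohr_mono (by linarith) (sub_mem_bohr ha.2 ht'), ?_⟩
    rwa [show a - (x0 + (a - x0 - t)) = t by abel]
  · intro t _ t' _ h
    simpa using h

lemma avg_y (A : Finset G) (Γ : Finset (AddChar G ℂ)) (ρ r r1 r2 : ℝ) (x0 : G) (h1 : r1 ≤ r)
    (h2 : r2 ≤ r) (hρ : 0 ≤ ρ) (hr1 : 0 ≤ r1) (hr2 : 0 ≤ r2) (α c : ℝ) (hα : 0 ≤ α)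
    (hreg : ((bohr Γ (ρ + r)).card : ℝ) ≤ (1 + c) * (bohr Γ ρ).card)
    (hd : α * (bohr Γ ρ).card ≤ (loc A x0 (bohr Γ ρ)).card) :
    ∃ y, 2 * α ≤ (1 + c) * ((loc A y (bohr Γ r1)).card / (bohr Γ r1).card +
      (loc A y (bohr Γ r2)).card / (bohr Γ r2).card) := by
  by_contra hcon
  push Not at hcon
  have hB : (0:ℝ) < (bohr Γ ρ).card := by exact_mod_cast bohr_card_pos (Γ := Γ) hρ
  have hB1 : (0:ℝ) < (bohr Γ r1).card := by exact_mod_cast bohr_card_pos (Γ := Γ) hr1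
  have hB2 : (0:ℝ) < (bohr Γ r2).card := by exact_mod_cast bohr_card_pos (Γ := Γ) hr2
  have hS : (bohr Γ (ρ + r)).Nonempty := Finset.card_pos.1 (bohr_card_pos (by linarith))
  have hS0 : (0:ℝ) < (bohr Γ (ρ+r)).card := by exact_mod_cast Finset.card_pos.2 hS
  have hc : 0 < 1 + c := by
    by_contra h
    push Not at h
    nlinarith
  have e : ∀ r', 0 < ((bohr Γ r').card : ℝ) → r' ≤ r → α * (bohr Γ ρ).card ≤
      ∑ b ∈ bohr Γ (ρ + r), ((loc A (x0 + b) (bohr Γ r')).card / (bohr Γ r').card : ℝ) := by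
    intro r' h0 h'
    have := avg_sum A Γ ρ r r' x0 h'
    rw [← Finset.sum_div, le_div_iff₀ h0]
    have h3 : ((loc A x0 (bohr Γ ρ)).card : ℝ) * (bohr Γ r').card ≤
      ∑ b ∈ bohr Γ (ρ + r), ((loc A (x0 + b) (bohr Γ r')).card : ℝ) := by exact_mod_cast this
    exact (mul_le_mul_of_nonneg_right hd h0.le).trans h3
  have e1 := e r1 hB1 h1
  have e2 := e r2 hB2 h2
  have e3 := Finset.sum_lt_sum_of_nonempty hS (fun b _ => hcon (x0 + b))
  rw [← Finset.mul_sum, Finset.sum_add_distrib, Finset.sum_const, nsmul_eq_mul] at e3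
  have e4 : (1 + c) * (2 * (α * (bohr Γ ρ).card)) < (bohr Γ (ρ + r)).card * (2 * α) := by
    refine lt_of_le_of_lt ?_ e3
    gcongr
    linarith
  have e5 : ((bohr Γ (ρ + r)).card : ℝ) * (2 * α) ≤ (1 + c) * (bohr Γ ρ).card * (2 * α) := by gcongr
  linarith

/-- number of representations -/
def rep (A1 A2 : Finset G) (q : G) : ℕ := (A1.filter (fun a => q - a ∈ A2)).card

/-- popular sums -/
def pop (A1 A2 : Finset G) : Finset G := (A1 + A2).filter (fun q => 10 ≤ rep A1 A2 q)

lemma select (h2 : ∀ a b : G, a + a = b + b → a = b) (A1 A2 E : Finset G) (q : G)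
    (hq : q ∈ pop A1 A2) (hE : E.card ≤ 4) :
    ∃ a ∈ A1, ∃ b ∈ A2, a + b = q ∧ a ≠ b ∧ a ∉ E ∧ b ∉ E := by
  have hr : 10 ≤ rep A1 A2 q := (Finset.mem_filter.1 hq).2
  let F : Finset G := E ∪ E.image (fun e => q - e) ∪ Finset.univ.filter (fun a => a + a = q)
  have hF : F.card ≤ 9 := by
    have h3 : (Finset.univ.filter (fun a : G => a + a = q)).card ≤ 1 := by
      rw [Finset.card_le_one]
      intro a ha b hb
      simp only [Finset.mem_filter, Finset.mem_univ, true_and] at ha hb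
      exact h2 a b (ha.trans hb.symm)
    have h4 := Finset.card_image_le (s := E) (f := fun e => q - e)
    have h5 := Finset.card_union_le (E ∪ E.image (fun e => q - e)) (Finset.univ.filter (fun a => a + a = q))
    have h6 := Finset.card_union_le E (E.image (fun e => q - e))
    change (E ∪ E.image (fun e => q - e) ∪ Finset.univ.filter (fun a => a + a = q)).card ≤ 9
    omega
  obtain ⟨a, ha, haF⟩ := Finset.exists_mem_notMem_of_card_lt_card
    (s := F) (t := A1.filter (fun a => q - a ∈ A2)) (by unfold rep at hr; omega)
  rw [Finset.mem_filter] at ha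
  simp only [F, Finset.mem_union, Finset.mem_image, Finset.mem_filter, Finset.mem_univ, true_and,
    not_or, not_exists, not_and] at haF
  refine ⟨a, ha.1, q - a, ha.2, by abel, ?_, haF.1.1, ?_⟩
  · intro h
    exact haF.2 (by nth_rewrite 2 [h]; abel)
  · intro h
    exact haF.1.2 _ h (by abel)

lemma find_sol (h2 : ∀ a b : G, a + a = b + b → a = b) (A A1 A2 : Finset G) (hA1 : A1 ⊆ A) (hA2 : A2 ⊆ A)
    (hno : ∀ x : Fin 6 → G, (∀ i, x i ∈ A) → Function.Injective x →
      x 0 + x 1 + x 2 + x 3 + x 4 ≠ 5 • x 5)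
    (a5 a6 : G) (h5 : a5 ∈ A) (h6 : a6 ∈ A) (h56 : a5 ≠ a6) (q : G) (hq : q ∈ pop A1 A2)
    (hq' : 5 • a6 - a5 - q ∈ pop A1 A2) : False := by
  obtain ⟨a3, h3, a4, h4, h34, hne, h3E, h4E⟩ := select h2 A1 A2 {a5, a6} _ hq' (by
    exact (Finset.card_le_two).trans (by norm_num))
  obtain ⟨a1, h1, a2, h2', h12, hne', h1E, h2E⟩ := select h2 A1 A2 {a3, a4, a5, a6} _ hq
    (Finset.card_le_four)
  simp only [Finset.mem_insert, Finset.mem_singleton, not_or] at h3E h4E h1E h2E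
  refine hno ![a1, a2, a3, a4, a5, a6] ?_ ?_ ?_
  · intro i
    fin_cases i <;> simp <;> first | exact hA1 h1 | exact hA2 h2' | exact hA1 h3 | exact hA2 h4 | exact h5 | exact h6
  · intro i j hij
    revert i j
    change Function.Injective ![a1, a2, a3, a4, a5, a6]
    rw [← List.nodup_ofFn]
    simp only [List.ofFn_succ, List.ofFn_zero, List.nodup_cons, List.mem_cons, Matrix.cons_val_zero,
      Matrix.cons_val_succ, List.not_mem_nil, not_or, or_false, not_false_eq_true, List.nodup_nil,
      and_true]
    tauto
  · simp only [Matrix.cons_val]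
    rw [h12, add_assoc q, h34]; abel

lemma pop_pairs (A1 A2 : Finset G) :
    (A1.card : ℝ) * A2.card - 9 * (A1 + A2).card ≤ ∑ a ∈ A1, ∑ b ∈ A2, ind (pop A1 A2) (a + b) := by
  have h1 : ∀ a ∈ A1, ∀ b ∈ A2, (1:ℝ) - ind (pop A1 A2) (a + b) ≤
      if (a + b) ∈ (A1 + A2) \ pop A1 A2 then 1 else 0 := by
    intro a ha b hb
    unfold ind
    have := Finset.add_mem_add ha hb
    by_cases h : a + b ∈ pop A1 A2 <;> simp [h, this]
  have h2 : ∑ a ∈ A1, ∑ b ∈ A2, ((1:ℝ) - ind (pop A1 A2) (a + b)) ≤ 9 * (A1 + A2).card := by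
    refine (Finset.sum_le_sum fun a ha => Finset.sum_le_sum fun b hb => h1 a ha b hb).trans ?_
    have h3 : ∑ a ∈ A1, ∑ b ∈ A2, (if (a + b) ∈ (A1 + A2) \ pop A1 A2 then (1:ℝ) else 0) =
        ∑ q ∈ (A1 + A2) \ pop A1 A2, (rep A1 A2 q : ℝ) := by
      have h4 : ∀ q, (rep A1 A2 q : ℝ) = ∑ a ∈ A1, ∑ b ∈ A2, if b = q - a then 1 else 0 := by
        intro q
        unfold rep
        rw [Finset.card_filter]
        push_cast
        refine Finset.sum_congr rfl fun a _ => ?_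
        rw [Finset.sum_ite_eq']
      simp only [h4]
      rw [Finset.sum_comm]
      conv_rhs => rw [Finset.sum_comm]
      rw [Finset.sum_comm]
      refine Finset.sum_congr rfl fun a _ => ?_
      rw [Finset.sum_comm]
      refine Finset.sum_congr rfl fun b _ => ?_
      simp only [eq_sub_iff_add_eq', eq_comm (a := a + b)]
      rw [Finset.sum_ite_eq']
    rw [h3]
    calc _ ≤ ∑ q ∈ (A1 + A2) \ pop A1 A2, (9:ℝ) := by
          refine Finset.sum_le_sum fun q hq => ?_
          rw [Finset.mem_sdiff] at hq
          have : ¬ 10 ≤ rep A1 A2 q := fun h => hq.2 (Finset.mem_filter.2 ⟨hq.1, h⟩)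
          exact_mod_cast (by omega : rep A1 A2 q ≤ 9)
      _ = 9 * (((A1 + A2) \ pop A1 A2).card : ℝ) := by simp [mul_comm]
      _ ≤ _ := by
          gcongr
          exact Finset.sdiff_subset
  simp only [Finset.sum_sub_distrib, Finset.sum_const, nsmul_eq_mul, mul_one] at h2
  linarith

/-- weight counting -/
lemma count_Q (A1 A2 X Q : Finset G) (hA1 : A1.Nonempty) (hA2 : A2.Nonempty) (hX : X.Nonempty) (η M : ℝ)
    (hh : ∀ x ∈ X, 1 - η ≤ hfun Q A1 A2 x) (hM0 : 0 ≤ M)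
    (hM : ∀ u, ((loc A1 u X).card : ℝ) ≤ M) (hXs : ∀ x ∈ X, -x ∈ X) :
    ∃ a2 ∈ A2, (1 - η) * A1.card * X.card ≤
      M * ((A1 + X).filter (fun u => u + a2 ∈ Q)).card := by
  by_contra hcon
  push Not at hcon
  have hA1' : (0:ℝ) < A1.card := by exact_mod_cast hA1.card_pos
  have hA2' : (0:ℝ) < A2.card := by exact_mod_cast hA2.card_pos
  have h1 : (1 - η) * A1.card * X.card * A2.card ≤ ∑ a2 ∈ A2, ∑ x ∈ X, ∑ a ∈ A1, ind Q (a + x + a2) := by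
    have : ∑ x ∈ X, (1 - η) ≤ ∑ x ∈ X, hfun Q A1 A2 x := Finset.sum_le_sum hh
    have e : ∑ x ∈ X, hfun Q A1 A2 x =
        (∑ a2 ∈ A2, ∑ x ∈ X, ∑ a ∈ A1, ind Q (a + x + a2)) / (A1.card * A2.card) := by
      unfold hfun gfun
      simp only [← Finset.sum_div]
      rw [div_div, mul_comm (A2.card : ℝ)]
      congr 1
      rw [Finset.sum_comm' (s := A2) (t' := X) (s' := fun _ => A2) (t := fun _ => X) (by simp [and_comm])]
      refine Finset.sum_congr rfl fun x _ => Finset.sum_comm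
    rw [e, le_div_iff₀ (by positivity), Finset.sum_const, nsmul_eq_mul] at this
    linarith
  have h2 : ∀ a2 ∈ A2, ∑ x ∈ X, ∑ a ∈ A1, ind Q (a + x + a2) ≤
      M * ((A1 + X).filter (fun u => u + a2 ∈ Q)).card := by
    intro a2 _
    have e : ∑ x ∈ X, ∑ a ∈ A1, ind Q (a + x + a2) =
        ∑ u ∈ (A1 + X).filter (fun u => u + a2 ∈ Q), ((loc A1 u X).card : ℝ) := by
      have e1 : ∀ u, ((loc A1 u X).card : ℝ) = ∑ a ∈ A1, ∑ x ∈ X, if u = a + x then 1 else 0 := by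
        intro u
        unfold loc
        rw [Finset.card_filter]
        push_cast
        refine Finset.sum_congr rfl fun a _ => ?_
        simp only [← sub_eq_iff_eq_add']
        rw [Finset.sum_ite_eq]
        have : a - u ∈ X ↔ u - a ∈ X := by
          constructor
          · intro h; have := hXs _ h; rwa [neg_sub] at this
          · intro h; have := hXs _ h; rwa [neg_sub] at this
        simp only [this]
      simp only [e1]
      rw [Finset.sum_comm]
      conv_rhs => rw [Finset.sum_comm]
      refine Finset.sum_congr rfl fun a ha => ?_
      conv_rhs => rw [Finset.sum_comm]
      refine Finset.sum_congr rfl fun x hx => ?_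
      rw [Finset.sum_ite_eq']
      unfold ind
      simp [Finset.add_mem_add ha hx]
    rw [e]
    calc _ ≤ ∑ u ∈ (A1 + X).filter (fun u => u + a2 ∈ Q), M := Finset.sum_le_sum fun u _ => hM u
      _ = _ := by simp [mul_comm]
  have h3 : ∑ a2 ∈ A2, ∑ x ∈ X, ∑ a ∈ A1, ind Q (a + x + a2) < ∑ a2 ∈ A2, (1 - η) * A1.card * X.card :=
    Finset.sum_lt_sum_of_nonempty hA2 fun a2 h => (h2 a2 h).trans_lt (hcon a2 h)
  rw [Finset.sum_const, nsmul_eq_mul] at h3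
  linarith

lemma pigeon (Q S : Finset G) (z : G) (h1 : Q ⊆ S) (h2 : ∀ q ∈ Q, z - q ∈ S) (h : S.card < 2 * Q.card) :
    ∃ q ∈ Q, z - q ∈ Q := by
  by_contra hcon
  push Not at hcon
  have hd : Disjoint Q (Q.image (fun q => z - q)) := by
    rw [Finset.disjoint_left]
    intro q hq hq'
    obtain ⟨q', h', rfl⟩ := Finset.mem_image.1 hq'
    exact hcon q' h' hq
  have hs : Q ∪ Q.image (fun q => z - q) ⊆ S := by
    refine Finset.union_subset h1 ?_
    intro q hq
    obtain ⟨q', h', rfl⟩ := Finset.mem_image.1 hq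
    exact h2 _ h'
  have := Finset.card_le_card hs
  rw [Finset.card_union_of_disjoint hd, Finset.card_image_of_injective _ (fun a b h => by simpa using h)] at this
  omega

end stepA
end SSix

namespace SSix

section stepB
variable {G : Type} [AddCommGroup G] [Fintype G] [DecidableEq G]

/-- radius shrinking factor -/
def sfac (D M : ℕ) (R : ℝ) : ℝ :=
  (1 / (1280 * D)) * (1 / (10240 * D)) * (1 / (1280 * D)) * (1 / (1280 * D * M)) *
    (1 / (1600 * R * D)) * (1 / (40 * R * M))

lemma reg_mono (D : ℕ) (hD : 1 ≤ D) (c : ℝ) (Γ : Finset (AddChar G ℂ)) (ρ r : ℝ) (h : Reg D c Γ ρ)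
    (hr : r ≤ c * ρ / (20 * D)) : ((bohr Γ (ρ + r)).card : ℝ) ≤ (1 + c) * (bohr Γ ρ).card := by
  refine le_trans ?_ h
  exact Nat.cast_le.2 (Finset.card_le_card (bohr_mono (by linarith)))

lemma loc_add_subset (A X : Finset G) (y : G) (Γ : Finset (AddChar G ℂ)) (r r' : ℝ) (hX : X ⊆ bohr Γ r') :
    loc A y (bohr Γ r) + X ⊆ (bohr Γ (r + r')).image (fun b => y + b) := by
  intro z hz
  obtain ⟨a, ha, x, hx, rfl⟩ := Finset.mem_add.1 hz
  rw [mem_loc] at ha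
  refine Finset.mem_image.2 ⟨a - y + x, add_mem_bohr ha.2 (hX hx), by abel⟩

lemma loc_add_loc_subset (A A' : Finset G) (y : G) (Γ : Finset (AddChar G ℂ)) (r r' : ℝ) :
    loc A y (bohr Γ r) + loc A' y (bohr Γ r') ⊆ (bohr Γ (r + r')).image (fun b => y + y + b) := by
  intro z hz
  obtain ⟨a, ha, x, hx, rfl⟩ := Finset.mem_add.1 hz
  rw [mem_loc] at ha hx
  refine Finset.mem_image.2 ⟨(a - y) + (x - y), add_mem_bohr ha.2 hx.2, by abel⟩

set_option maxHeartbeats 2000000 in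
/-- One density increment step, radii given. -/
theorem step_core (A : Finset G) (h2 : ∀ a b : G, a + a = b + b → a = b)
    (hno : ∀ x : Fin 6 → G, (∀ i, x i ∈ A) → Function.Injective x →
      x 0 + x 1 + x 2 + x 3 + x 4 ≠ 5 • x 5)
    (D : ℕ) (hD1 : 1 ≤ D) (Γ : Finset (AddChar G ℂ)) (ρ ρ1 ρ2 ρ3 ρ4 ρ5 σ : ℝ) (hρ : 0 < ρ) (z1 : 0 < ρ1) (z2 : 0 < ρ2)
    (z3 : 0 < ρ3) (z4 : 0 < ρ4) (z5 : 0 < ρ5) (o1 : ρ1 ≤ ρ) (o2 : ρ2 ≤ ρ1) (o5 : ρ5 ≤ ρ2)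
    (x0 : G) (α R : ℝ)
    (hα : 0 < α) (hRα : 3 ≤ R * α) (hR : 3 ≤ R) (m k M : ℕ) (hm1 : 1 ≤ m) (hm : 20 * R ≤ 4 ^ m)
    (hk : 2 * Real.log (5 * R) * (1600 * m ^ 2) ≤ k)
    (hM : 8 * Real.log (8 * R ^ k) < M) (hreg : Reg D (1/32) Γ ρ)
    (b1 : ρ1 ≤ 1/32 * ρ / (20 * D)) (b2 : 8 * ρ2 ≤ 1/32 * ρ1 / (20 * D))
    (b3 : ρ3 ≤ 1/32 * ρ2 / (20 * D)) (b4 : M * ρ4 ≤ 1/32 * ρ3 / (20 * D))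
    (b5 : ρ5 ≤ 1 / (80 * R) * ρ4 / (20 * D))
    (r1 : Reg D (1/32) Γ ρ1) (r2 : Reg D (1/32) Γ ρ2) (r3 : Reg D (1/32) Γ ρ3)
    (r4 : Reg D (1 / (80 * R)) Γ ρ4) (s1 : σ ≤ ρ1) (s2 : σ ≤ ρ2)
    (hrad : ∀ Γ' : Finset (AddChar G ℂ), Γ'.card ≤ Γ.card + M → ∃ ρ6, 0 < ρ6 ∧ ρ6 ≤ ρ5 ∧ σ ≤ ρ6 ∧
      M * ρ6 ≤ 1 / (20 * R) ∧ Reg D (1/32) Γ' ρ6)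
    (hsize : 45 * R ^ 2 ≤ (bohr Γ σ).card)
    (hdens : α * (bohr Γ ρ).card ≤ (loc A x0 (bohr Γ ρ)).card) 
    (hNI : ∀ (Γ' : Finset (AddChar G ℂ)) (ρ' : ℝ) (x' : G), Γ'.card ≤ Γ.card + M →
      σ ≤ ρ' → ρ' ≤ ρ → Reg D (1/32) Γ' ρ' →
      ((loc A x' (bohr Γ' ρ')).card : ℝ) ≤ (33/32) * α * (bohr Γ' ρ').card) : False := by
  classical
  have hR0 : 0 < R := by linarith only [hR]
  -- sets
  set B := bohr Γ ρ with hBd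
  set B1 := bohr Γ ρ1 with hB1d
  set B2 := bohr Γ ρ2 with hB2d
  set B3 := bohr Γ ρ3 with hB3d
  have c1 : (0:ℝ) < B1.card := by exact_mod_cast bohr_card_pos (Γ := Γ) z1.le
  have c2 : (0:ℝ) < B2.card := by exact_mod_cast bohr_card_pos (Γ := Γ) z2.le
  have c3 : (0:ℝ) < B3.card := by exact_mod_cast bohr_card_pos (Γ := Γ) z3.le
  obtain ⟨y, hy⟩ := avg_y A Γ ρ ρ1 ρ1 ρ2 x0 le_rfl o2 hρ.le z1.le z2.le α (1/32) hα.le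
    (reg_mono D hD1 _ Γ ρ ρ1 hreg b1) hdens
  set A1 := loc A y B1 with hA1d
  set A2 := loc A y B2 with hA2d
  have n1 := hNI Γ ρ1 y (by omega) s1 o1 r1
  have n2 := hNI Γ ρ2 y (by omega) s2 (o2.trans o1) r2
  have n1' : (A1.card : ℝ) / B1.card ≤ 33/32 * α := by rw [div_le_iff₀ c1]; exact n1
  have n2' : (A2.card : ℝ) / B2.card ≤ 33/32 * α := by rw [div_le_iff₀ c2]; exact n2
  have d1 : 9/10 * α * B1.card ≤ A1.card := by
    rw [← le_div_iff₀ c1]; linarith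
  have d2 : 9/10 * α * B2.card ≤ A2.card := by
    rw [← le_div_iff₀ c2]; linarith
  have d1' : 2 * B1.card ≤ R * A1.card := by
    have : R * (9/10 * α * B1.card) ≤ R * A1.card := by gcongr
    have h3 : 3 * (B1.card : ℝ) ≤ R * α * B1.card := by gcongr
    linarith only [this, h3, c1]
  have d2' : 2 * B2.card ≤ R * A2.card := by
    have : R * (9/10 * α * B2.card) ≤ R * A2.card := by gcongr
    have h3 : 3 * (B2.card : ℝ) ≤ R * α * B2.card := by gcongr
    linarith only [this, h3, c2]
  have a1 : (0:ℝ) < A1.card := by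
    have : 0 < 9/10 * α * B1.card := by positivity
    linarith
  have a2 : (0:ℝ) < A2.card := by
    have : 0 < 9/10 * α * B2.card := by positivity
    linarith
  have A1n : A1.Nonempty := Finset.card_pos.1 (by exact_mod_cast a1)
  have A2n : A2.Nonempty := Finset.card_pos.1 (by exact_mod_cast a2)
  have hB2big : 45 * R ^ 2 ≤ B2.card := by
    refine hsize.trans ?_
    exact_mod_cast Finset.card_le_card (bohr_mono s2)
  have hA2big : 90 * R ≤ A2.card := by
    have : R * (90 * R) ≤ R * A2.card := by linarith only [hB2big, d2']
    exact le_of_mul_le_mul_left this hR0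
  -- sumset size
  have hB1p : ∀ r, r ≤ 8 * ρ2 → ((bohr Γ (ρ1 + r)).card : ℝ) ≤ 33/32 * B1.card := by
    intro r hr
    have := reg_mono D hD1 _ Γ ρ1 r r1 (hr.trans b2)
    linarith
  have hsum : ((A1 + A2).card : ℝ) ≤ R * A1.card := by
    have h := Finset.card_le_card (loc_add_loc_subset A A y Γ ρ1 ρ2)
    have h' : (A1 + A2).card ≤ (bohr Γ (ρ1 + ρ2)).card := h.trans Finset.card_image_le
    have h'' : ((A1 + A2).card : ℝ) ≤ (bohr Γ (ρ1 + ρ2)).card := by exact_mod_cast h'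
    linarith [hB1p ρ2 (by linarith)]
  set Q := pop A1 A2 with hQd
  have hQs : Q ⊆ A1 + A2 := Finset.filter_subset _ _
  have hQR : (Q.card : ℝ) ≤ R * A1.card := by
    refine le_trans ?_ hsum
    exact_mod_cast Finset.card_le_card hQs
  have hh0 : 9/10 ≤ hfun Q A1 A2 0 := by
    have h := pop_pairs A1 A2
    unfold hfun gfun
    simp only [add_zero]
    rw [← Finset.sum_div, div_div, le_div_iff₀ (by positivity)]
    have : 90 * R * A1.card ≤ A2.card * A1.card := by gcongr
    have h9 : 9 * ((A1 + A2).card : ℝ) ≤ 9 * (R * A1.card) := by gcongr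
    linarith only [this, h, h9]
  -- Croot-Sisask
  have hV : ((Finset.univ.filter (fun v => ∃ a ∈ A2, v + a ∈ Q)).card : ℝ) ≤ R * A1.card := by
    have h : Finset.univ.filter (fun v => ∃ a ∈ A2, v + a ∈ Q) ⊆
        (bohr Γ (ρ1 + (ρ2 + ρ2))).image (fun b => y + b) := by
      intro v hv
      obtain ⟨a, ha, hva⟩ := (Finset.mem_filter.1 hv).2
      obtain ⟨b, hb, hb'⟩ := Finset.mem_image.1 (loc_add_loc_subset A A y Γ ρ1 ρ2 (hQs hva))
      rw [hA2d, mem_loc] at ha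
      have := sub_mem_bohr hb ha.2
      refine Finset.mem_image.2 ⟨b - (a - y), by rwa [add_assoc] at this, ?_⟩
      have hv' : v = y + y + b - a := by rw [hb']; abel
      rw [hv']; abel
    have h' := (Finset.card_le_card h).trans Finset.card_image_le
    have h'' : ((Finset.univ.filter (fun v => ∃ a ∈ A2, v + a ∈ Q)).card : ℝ) ≤
      (bohr Γ (ρ1 + (ρ2 + ρ2))).card := by exact_mod_cast h'
    linarith [hB1p (ρ2 + ρ2) (by linarith)]
  have hm0 : (0:ℝ) < m := by exact_mod_cast hm1
  obtain ⟨T, hTS, hTc, hTper⟩ := croot_sisask A1 A2 B3 Q A1n A2n R (1 / (40 * m)) (by linarith)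
    (by positivity) k (by
      have : (k:ℝ) * (1 / (40 * m)) ^ 2 = k / (1600 * m ^ 2) := by field_simp; norm_num
      rw [this, le_div_iff₀ (by positivity)]
      exact hk) hV
  have hRk : 0 < R ^ k := by positivity
  have hTc' : 1 / (2 * R ^ k) * B3.card ≤ T.card := by
    have h1 : ((A2 + B3).card : ℝ) ≤ R * A2.card := by
      have h := (Finset.card_le_card (loc_add_subset A B3 y Γ ρ2 ρ3 subset_rfl)).trans Finset.card_image_le
      have h'' : ((A2 + B3).card : ℝ) ≤ (bohr Γ (ρ2 + ρ3)).card := by exact_mod_cast h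
      have := reg_mono D hD1 _ Γ ρ2 ρ3 r2 b3
      linarith
    have h3 : (B3.card : ℝ) * (A2.card : ℝ) ^ k ≤ 2 * (R * A2.card) ^ k * T.card := by
      refine hTc.trans ?_
      gcongr
    rw [mul_pow] at h3
    have h4 : (B3.card : ℝ) * (A2.card : ℝ) ^ k ≤ (2 * R ^ k * T.card) * (A2.card : ℝ) ^ k := by linarith
    have h5 := le_of_mul_le_mul_right h4 (by positivity)
    rw [one_div, inv_mul_le_iff₀ (by positivity)]
    exact h5
  have hT0 : (0:ℝ) < T.card := lt_of_lt_of_le (by positivity) hTc'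
  have hTn : T.Nonempty := Finset.card_pos.1 (by exact_mod_cast hT0)
  -- Chang
  obtain ⟨Λ, hΛ, hΛ'⟩ := chang Γ ρ3 ρ4 ρ5 (1 / (80 * R)) z3.le z4.le z5.le M (by
      have := reg_mono D hD1 _ Γ ρ3 (M * ρ4) r3 b4
      linarith) (reg_mono D hD1 _ Γ ρ4 ρ5 r4 b5) T hTS hTn (1 / (2 * R ^ k)) (by positivity) hTc' (by
      have : 4 / (1 / (2 * R ^ k)) = 8 * R ^ k := by field_simp; norm_num
      rw [this]; exact hM)
  have hcard : (Γ ∪ Λ).card ≤ Γ.card + M := (Finset.card_union_le _ _).trans (by omega)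
  obtain ⟨ρ6, z6, o6, s6, hradM, r6⟩ := hrad (Γ ∪ Λ) hcard
  set X := bohr (Γ ∪ Λ) ρ6 with hXd
  have hXn : X.Nonempty := ⟨0, zero_mem_bohr z6.le⟩
  have hX0 : (0:ℝ) < X.card := by exact_mod_cast hXn.card_pos
  have hsq : Real.sqrt (Q.card / A1.card) ≤ R := by
    rw [Real.sqrt_le_left hR0.le, div_le_iff₀ a1]
    have : R * A1.card ≤ R ^ 2 * A1.card :=
      mul_le_mul_of_nonneg_right (show R ≤ R ^ 2 by nlinarith only [hR]) a1.le
    linarith only [this, hQR]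
  have hhX : ∀ x ∈ X, 1 - 4/10 ≤ hfun Q A1 A2 x := by
    intro x hx
    have h := smooth Q A1 A2 T A1n hTn (1 / (40 * m)) (1 / (10 * R)) (by positivity) (by positivity) m
      hTper x (by
        intro γ hγ
        refine (hΛ' ρ6 z6.le o6 x hx γ hγ).trans ?_
        have : 4 * (1 / (80 * R)) + 1 / (20 * R) = 1 / (10 * R) := by field_simp; norm_num
        linarith) 0
    rw [zero_add] at h
    have h3 : 4 * (1 / (40 * (m:ℝ))) * m = 1/10 := by field_simp; norm_num
    have h4 : (2 * (1 / 4 : ℝ) ^ m + 1 / (10 * R)) * Real.sqrt (Q.card / A1.card) ≤ 2/10 := by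
      calc _ ≤ (2 * (1 / 4 : ℝ) ^ m + 1 / (10 * R)) * R := by gcongr
        _ ≤ _ := by
          have h5 : (1/4 : ℝ) ^ m * 4 ^ m = 1 := by rw [← mul_pow]; norm_num
          have h6 : (1/4 : ℝ) ^ m * (20 * R) ≤ 1 := by
            have : (1/4 : ℝ) ^ m * (20 * R) ≤ (1/4 : ℝ) ^ m * 4 ^ m := by gcongr
            exact this.trans h5.le
          have h7 : 1 / (10 * R) * R = 1/10 := by field_simp
          rw [add_mul, h7]; linarith
    rw [h3] at h
    have := (abs_le.1 (h.trans (add_le_add_right h4 _))).1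
    linarith
  obtain ⟨b2', hb2', hcount⟩ := count_Q A1 A2 X Q A1n A2n hXn (4/10) (33/32 * α * X.card) hhX
    (by positivity) (by
      intro u
      have h := hNI (Γ ∪ Λ) ρ6 u hcard s6 (by linarith) r6
      refine le_trans ?_ h
      refine Nat.cast_le.2 (Finset.card_le_card ?_)
      intro a ha
      rw [mem_loc] at ha ⊢
      exact ⟨(mem_loc.1 ha.1).1, ha.2⟩) (fun x hx => neg_mem_bohr hx)
  set U := (A1 + X).filter (fun u => u + b2' ∈ Q) with hUd
  have hU : (1 - 4/10) * (9/10) * (B1.card : ℝ) ≤ 33/32 * (U.card : ℝ) := by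
    have h3 : (1 - 4/10) * A1.card * X.card = ((1 - 4/10) * A1.card) * (X.card : ℝ) := by ring
    have h4 : ((1 - 4/10) * (A1.card:ℝ)) * X.card ≤ (33/32 * α * U.card) * X.card := by linarith
    have h5 := le_of_mul_le_mul_right h4 hX0
    have h6 : α * ((1 - 4/10) * (9/10) * (B1.card : ℝ)) ≤ α * (33/32 * (U.card : ℝ)) := by
      linarith only [h5, d1]
    exact le_of_mul_le_mul_left h6 hα
  set Q' := U.image (fun u => u + b2') with hQ'd
  have hQ'c : Q'.card = U.card := Finset.card_image_of_injective _ (add_left_injective b2')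
  have hQ'Q : Q' ⊆ Q := by
    intro q hq
    obtain ⟨u, hu, rfl⟩ := Finset.mem_image.1 hq
    exact (Finset.mem_filter.1 hu).2
  have hXB : X ⊆ bohr Γ ρ6 := bohr_anti Finset.subset_union_left le_rfl
  have hb2B := (mem_loc.1 hb2').2
  have hQ'S : ∀ q ∈ Q', q - (y + y) ∈ bohr Γ (ρ1 + ρ6 + ρ2) := by
    intro q hq
    obtain ⟨u, hu, rfl⟩ := Finset.mem_image.1 hq
    obtain ⟨b, hb, rfl⟩ := Finset.mem_image.1 (loc_add_subset A X y Γ ρ1 ρ6 hXB (Finset.mem_filter.1 hu).1)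
    have := add_mem_bohr hb hb2B
    rwa [show y + b + b2' - (y + y) = b + (b2' - y) by abel]
  obtain ⟨a5, h5, a6, h6, h56⟩ := Finset.one_lt_card.1 (show 1 < A2.card by
    have : (1:ℝ) < A2.card := by linarith
    exact_mod_cast this)
  have h5' := mem_loc.1 h5
  have h6' := mem_loc.1 h6
  have hz : 5 • a6 - a5 - (y + y + y + y) ∈ bohr Γ (ρ2 + ρ2 + ρ2 + ρ2 + ρ2 + ρ2) := by
    have := sub_mem_bohr (add_mem_bohr (add_mem_bohr (add_mem_bohr (add_mem_bohr h6'.2 h6'.2) h6'.2) h6'.2)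
      h6'.2) h5'.2
    rwa [show 5 • a6 - a5 - (y + y + y + y) =
      (a6 - y) + (a6 - y) + (a6 - y) + (a6 - y) + (a6 - y) - (a5 - y) by abel]
  obtain ⟨q, hq, hq'⟩ := pigeon Q' ((bohr Γ (ρ1 + 8 * ρ2)).image (fun b => y + y + b)) (5 • a6 - a5) (by
      intro q hq
      refine Finset.mem_image.2 ⟨q - (y + y), bohr_mono (by linarith) (hQ'S q hq), by abel⟩) (by
      intro q hq
      refine Finset.mem_image.2 ⟨(5 • a6 - a5 - (y + y + y + y)) - (q - (y + y)),
        bohr_mono (by linarith) (sub_mem_bohr hz (hQ'S q hq)), by abel⟩) (by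
      refine lt_of_le_of_lt Finset.card_image_le ?_
      rw [hQ'c]
      have h7 := hB1p (8 * ρ2) le_rfl
      have : ((bohr Γ (ρ1 + 8 * ρ2)).card : ℝ) < 2 * U.card := by linarith only [h7, hU, c1]
      exact_mod_cast this)
  exact find_sol h2 A A1 A2 (Finset.filter_subset _ _) (Finset.filter_subset _ _) hno a5 a6 h5'.1 h6'.1 h56 q
    (hQ'Q hq) (hQ'Q hq')

set_option maxHeartbeats 2000000 in
/-- One density increment step. -/
theorem step (A : Finset G) (h2 : ∀ a b : G, a + a = b + b → a = b)
    (hno : ∀ x : Fin 6 → G, (∀ i, x i ∈ A) → Function.Injective x →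
      x 0 + x 1 + x 2 + x 3 + x 4 ≠ 5 • x 5)
    (D : ℕ) (Γ : Finset (AddChar G ℂ)) (ρ : ℝ) (hρ : 0 < ρ) (hρ2 : ρ ≤ 2) (x0 : G) (α R : ℝ)
    (hα : 0 < α) (hRα : 3 ≤ R * α) (hR : 3 ≤ R) (m k M : ℕ) (hm1 : 1 ≤ m) (hm : 20 * R ≤ 4 ^ m)
    (hk : 2 * Real.log (5 * R) * (1600 * m ^ 2) ≤ k)
    (hM : 8 * Real.log (8 * R ^ k) < M) (hD : Γ.card + M ≤ D) (hreg : Reg D (1/32) Γ ρ)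
    (hsize : 45 * R ^ 2 ≤ (bohr Γ (sfac D M R * ρ)).card)
    (hdens : α * (bohr Γ ρ).card ≤ (loc A x0 (bohr Γ ρ)).card) :
    ∃ (Γ' : Finset (AddChar G ℂ)) (ρ' : ℝ) (x' : G), Γ'.card ≤ Γ.card + M ∧ sfac D M R * ρ ≤ ρ' ∧ ρ' ≤ ρ ∧
      Reg D (1/32) Γ' ρ' ∧ (33/32) * α * (bohr Γ' ρ').card ≤ (loc A x' (bohr Γ' ρ')).card := by
  classical
  by_contra hcon
  have hNI : ∀ (Γ' : Finset (AddChar G ℂ)) (ρ' : ℝ) (x' : G), Γ'.card ≤ Γ.card + M →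
      sfac D M R * ρ ≤ ρ' → ρ' ≤ ρ → Reg D (1/32) Γ' ρ' →
      ((loc A x' (bohr Γ' ρ')).card : ℝ) ≤ (33/32) * α * (bohr Γ' ρ').card := by
    intro Γ' ρ' x' a b b' c
    by_contra h
    push Not at h
    exact hcon ⟨Γ', ρ', x', a, b, b', c, h.le⟩
  have hM1 : 1 ≤ M := by
    by_contra h
    have h0 : M = 0 := by omega
    rw [h0] at hM
    have : 0 ≤ Real.log (8 * R ^ k) := Real.log_nonneg (by
      have : 1 ≤ R ^ k := one_le_pow₀ (by linarith)
      linarith)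
    push_cast at hM
    linarith
  have hD1 : 1 ≤ D := by omega
  have hDr : (1:ℝ) ≤ D := by exact_mod_cast hD1
  have hMr : (1:ℝ) ≤ M := by exact_mod_cast hM1
  have hD0 : (0:ℝ) < D := by linarith
  have hM0 : (0:ℝ) < M := by linarith
  have hR0 : 0 < R := by linarith
  -- factors
  obtain ⟨t1, ht1⟩ : ∃ t : ℝ, t = 1 / (1280 * D) := ⟨_, rfl⟩
  obtain ⟨t2, ht2⟩ : ∃ t : ℝ, t = 1 / (10240 * D) := ⟨_, rfl⟩
  obtain ⟨t4, ht4⟩ : ∃ t : ℝ, t = 1 / (1280 * D * M) := ⟨_, rfl⟩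
  obtain ⟨t5, ht5⟩ : ∃ t : ℝ, t = 1 / (1600 * R * D) := ⟨_, rfl⟩
  obtain ⟨t6, ht6⟩ : ∃ t : ℝ, t = 1 / (40 * R * M) := ⟨_, rfl⟩
  have hs : sfac D M R = t1 * t2 * t1 * t4 * t5 * t6 := by rw [ht1, ht2, ht4, ht5, ht6]; rfl
  have hone : ∀ x : ℝ, 1 ≤ x → 0 < 1 / x ∧ 1 / x ≤ 1 := by
    intro x hx
    have hx0 : 0 < x := by linarith
    exact ⟨by positivity, by rw [div_le_one hx0]; exact hx⟩
  have hRD : 1 ≤ R * D := by nlinarith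
  have hRM : 1 ≤ R * M := by nlinarith
  have hDM : 1 ≤ (D:ℝ) * M := by nlinarith
  obtain ⟨p1, q1⟩ : 0 < t1 ∧ t1 ≤ 1 := by rw [ht1]; exact hone _ (by linarith)
  obtain ⟨p2, q2⟩ : 0 < t2 ∧ t2 ≤ 1 := by rw [ht2]; exact hone _ (by linarith)
  obtain ⟨p4, q4⟩ : 0 < t4 ∧ t4 ≤ 1 := by rw [ht4]; exact hone _ (by nlinarith only [hRD, hRM, hDM])
  obtain ⟨p5, q5⟩ : 0 < t5 ∧ t5 ≤ 1 := by rw [ht5]; exact hone _ (by nlinarith only [hRD, hRM, hDM])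
  obtain ⟨p6, q6⟩ : 0 < t6 ∧ t6 ≤ 1 := by rw [ht6]; exact hone _ (by nlinarith only [hRD, hRM, hDM])
  have hle : ∀ x t : ℝ, 0 < x → t ≤ 1 → x * t ≤ x := fun x t hx ht => by nlinarith
  -- radii
  have hΓD : Γ.card ≤ D := by omega
  obtain ⟨ρ1, l1, u1, r1⟩ := exists_reg D hD1 (1/32) (by norm_num) (by norm_num) Γ hΓD (2 * (t1 * ρ))
    (by positivity)
  have l1' : t1 * ρ ≤ ρ1 := by linarith
  have z1 : 0 < ρ1 := by have : 0 < t1 * ρ := by positivity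
                         linarith
  obtain ⟨ρ2, l2, u2, r2⟩ := exists_reg D hD1 (1/32) (by norm_num) (by norm_num) Γ hΓD (2 * (t2 * ρ1))
    (by positivity)
  have l2' : t2 * ρ1 ≤ ρ2 := by linarith
  have z2 : 0 < ρ2 := by have : 0 < t2 * ρ1 := by positivity
                         linarith
  obtain ⟨ρ3, l3, u3, r3⟩ := exists_reg D hD1 (1/32) (by norm_num) (by norm_num) Γ hΓD (2 * (t1 * ρ2))
    (by positivity)
  have l3' : t1 * ρ2 ≤ ρ3 := by linarith
  have z3 : 0 < ρ3 := by have : 0 < t1 * ρ2 := by positivity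
                         linarith
  have hc' : 0 < 1 / (80 * R) := by positivity
  have hc'1 : 1 / (80 * R) ≤ 1 := by rw [div_le_one (by positivity)]; linarith
  obtain ⟨ρ4, l4, u4, r4⟩ := exists_reg D hD1 (1 / (80 * R)) hc' hc'1 Γ hΓD (2 * (t4 * ρ3))
    (by positivity)
  have l4' : t4 * ρ3 ≤ ρ4 := by linarith
  have z4 : 0 < ρ4 := by have : 0 < t4 * ρ3 := by positivity
                         linarith
  obtain ⟨ρ5, hρ5⟩ : ∃ x, x = t5 * ρ4 := ⟨_, rfl⟩
  have z5 : 0 < ρ5 := by rw [hρ5]; positivity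
  -- upper bounds
  have e1 : 2 * t1 = 1/32 / (20 * D) := by rw [ht1]; field_simp; norm_num
  have e2 : 16 * t2 = 1/32 / (20 * D) := by rw [ht2]; field_simp; norm_num
  have e4 : M * (2 * t4) = 1/32 / (20 * D) := by rw [ht4]; field_simp; norm_num
  have e5 : t5 = 1 / (80 * R) / (20 * D) := by rw [ht5]; field_simp; norm_num
  have b1 : ρ1 ≤ 1/32 * ρ / (20 * D) := by
    calc ρ1 ≤ 2 * t1 * ρ := by linarith
      _ = _ := by rw [e1]; ring
  have b2 : 8 * ρ2 ≤ 1/32 * ρ1 / (20 * D) := by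
    calc 8 * ρ2 ≤ 16 * t2 * ρ1 := by linarith
      _ = _ := by rw [e2]; ring
  have b3 : ρ3 ≤ 1/32 * ρ2 / (20 * D) := by
    calc ρ3 ≤ 2 * t1 * ρ2 := by linarith
      _ = _ := by rw [e1]; ring
  have b4 : M * ρ4 ≤ 1/32 * ρ3 / (20 * D) := by
    calc M * ρ4 ≤ M * (2 * (t4 * ρ3)) := by gcongr
      _ = M * (2 * t4) * ρ3 := by ring
      _ = _ := by rw [e4]; ring
  have b5 : ρ5 ≤ 1 / (80 * R) * ρ4 / (20 * D) := by rw [hρ5, e5]; apply le_of_eq; ring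
  have hD20 : ∀ x : ℝ, 0 < x → 1/32 * x / (20 * D) ≤ x / 640 := by
    intro x hx
    rw [div_le_div_iff₀ (by positivity) (by norm_num)]
    nlinarith only [hx, hDr]
  have o1 : ρ1 ≤ ρ := by linarith [hD20 ρ hρ]
  have o2 : ρ2 ≤ ρ1 := by linarith [hD20 ρ1 z1]
  have o3 : ρ3 ≤ ρ2 := by linarith [hD20 ρ2 z2]
  have o4 : ρ4 ≤ ρ3 := by
    have : ρ4 ≤ M * ρ4 := by nlinarith only [hMr, z4]
    linarith [hD20 ρ3 z3]
  have o5 : ρ5 ≤ ρ4 := by rw [hρ5]; nlinarith only [q5, z4]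
  -- lower bounds
  have g1 : t1 * t2 * t1 * t4 * t5 * t6 * ρ ≤ t1 * t2 * ρ := by
    have : t1 * t4 * t5 * t6 ≤ 1 := by
      refine mul_le_one₀ (mul_le_one₀ (mul_le_one₀ q1 p4.le q4) p5.le q5) p6.le q6
    have h0 : 0 < t1 * t2 * ρ := by positivity
    calc _ = t1 * t2 * ρ * (t1 * t4 * t5 * t6) := by ring
      _ ≤ _ := hle _ _ h0 this
  have g2 : t1 * t2 * ρ ≤ ρ2 := by
    calc _ = t2 * (t1 * ρ) := by ring
      _ ≤ t2 * ρ1 := by gcongr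
      _ ≤ _ := l2'
  have s2 : sfac D M R * ρ ≤ ρ2 := by rw [hs]; linarith
  have s1 : sfac D M R * ρ ≤ ρ1 := s2.trans o2
  have g4 : t4 * (t1 * (t2 * (t1 * ρ))) ≤ ρ4 := by
    calc _ ≤ t4 * (t1 * (t2 * ρ1)) := by gcongr
      _ ≤ t4 * (t1 * ρ2) := by gcongr
      _ ≤ t4 * ρ3 := by gcongr
      _ ≤ _ := l4'
  refine step_core A h2 hno D hD1 Γ ρ ρ1 ρ2 ρ3 ρ4 ρ5 (sfac D M R * ρ) hρ z1 z2 z3 z4 z5 o1 o2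
    (by linarith only [o3, o4, o5]) x0 α R hα hRα hR m k M hm1 hm hk hM hreg b1 b2 b3 b4 b5 r1 r2 r3 r4 s1 s2 ?_
    hsize hdens hNI
  intro Γ' hΓ'
  obtain ⟨ρ6, l6, u6, r6⟩ := exists_reg D hD1 (1/32) (by norm_num) (by norm_num) Γ' (by omega)
    (2 * (t6 * ρ5)) (by positivity)
  have l6' : t6 * ρ5 ≤ ρ6 := by linarith
  have z6 : 0 < ρ6 := by have : 0 < t6 * ρ5 := by positivity
                         linarith
  have s6 : sfac D M R * ρ ≤ ρ6 := by
    rw [hs]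
    calc _ = t6 * (t5 * (t4 * (t1 * (t2 * (t1 * ρ))))) := by ring
      _ ≤ t6 * (t5 * ρ4) := by gcongr
      _ ≤ _ := by rw [← hρ5]; exact l6'
  have e6 : M * (2 * t6) = 1 / (20 * R) := by rw [ht6]; field_simp; norm_num
  have ht6' : t6 ≤ 1/2 := by
    rw [ht6, div_le_div_iff₀ (by positivity) (by norm_num)]; nlinarith only [hRM]
  have o6 : ρ6 ≤ ρ5 := by
    have : t6 * ρ5 ≤ 1/2 * ρ5 := by gcongr
    linarith only [u6, this]
  have hradM : M * ρ6 ≤ 1 / (20 * R) := by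
    have hρ5' : ρ5 ≤ 1 := by linarith only [hD20 ρ hρ, o1, o2, o3, o4, o5, b1, hρ2]
    calc M * ρ6 ≤ M * (2 * (t6 * ρ5)) := by gcongr
      _ = M * (2 * t6) * ρ5 := by ring
      _ ≤ M * (2 * t6) * 1 := by gcongr
      _ = _ := by rw [mul_one, e6]
  exact ⟨ρ6, z6, o6, s6, hradM, r6⟩

end stepB
end SSix

namespace SSix

section iter
variable {G : Type} [AddCommGroup G] [Fintype G] [DecidableEq G]

lemma loc_card_le (A : Finset G) (y : G) (B : Finset G) : (loc A y B).card ≤ B.card := by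
  refine Finset.card_le_card_of_injOn (fun a => a - y) ?_ ?_
  · intro a ha; exact (mem_loc.1 ha).2
  · intro a _ b _ h; simpa using h

lemma sfac_pos (D M : ℕ) (R : ℝ) (hD : 1 ≤ D) (hM : 1 ≤ M) (hR : 3 ≤ R) : 0 < sfac D M R := by
  have : (0:ℝ) < D := by exact_mod_cast hD
  have : (0:ℝ) < M := by exact_mod_cast hM
  have : 0 < R := by linarith
  unfold sfac; positivity

lemma sfac_eq (D M : ℕ) (R : ℝ) : sfac D M R =
    1 / (1280 * 10240 * 1280 * 1280 * 1600 * 40 * (D ^ 5 * R ^ 2 * M ^ 2)) := by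
  unfold sfac
  simp only [one_div, mul_inv]
  ring

lemma iterate_step (A : Finset G) (h2 : ∀ a b : G, a + a = b + b → a = b)
    (hno : ∀ x : Fin 6 → G, (∀ i, x i ∈ A) → Function.Injective x →
      x 0 + x 1 + x 2 + x 3 + x 4 ≠ 5 • x 5)
    (D I : ℕ) (α R : ℝ)
    (hα : 0 < α) (hRα : 3 ≤ R * α) (hR : 3 ≤ R) (m k M : ℕ) (hm1 : 1 ≤ m) (hm : 20 * R ≤ 4 ^ m)
    (hk : 2 * Real.log (5 * R) * (1600 * m ^ 2) ≤ k) (hM1 : 1 ≤ M)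
    (hM : 8 * Real.log (8 * R ^ k) < M) (hD : (I + 1) * M ≤ D) (hs1 : sfac D M R ≤ 1)
    (hsize : ∀ Γ : Finset (AddChar G ℂ), Γ.card ≤ D →
      45 * R ^ 2 ≤ (bohr Γ (2 * sfac D M R ^ (I + 1))).card)
    (hdens : α * Fintype.card G ≤ A.card) (i : ℕ) (hi : i ≤ I) :
    ∃ (Γ : Finset (AddChar G ℂ)) (ρ : ℝ) (x : G), Γ.card ≤ i * M ∧ 2 * sfac D M R ^ i ≤ ρ ∧ ρ ≤ 2 ∧
      Reg D (1/32) Γ ρ ∧ (33/32) ^ i * α * (bohr Γ ρ).card ≤ (loc A x (bohr Γ ρ)).card := by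
  have hD1 : 1 ≤ D := by nlinarith
  have hs0 := sfac_pos D M R hD1 hM1 hR
  induction i with
  | zero =>
    refine ⟨∅, 2, 0, by simp, by simp, le_rfl, ?_, ?_⟩
    · unfold Reg
      have hD0 : (0:ℝ) < D := by exact_mod_cast hD1
      rw [bohr_two ∅ le_rfl, bohr_two ∅ (by have : 0 < 1/32 * 2 / (20 * (D:ℝ)) := by positivity
                                            linarith)]
      have : (0:ℝ) ≤ (Finset.univ : Finset G).card := Nat.cast_nonneg _
      linarith
    · rw [bohr_two ∅ le_rfl]
      have : loc A 0 Finset.univ = A := by ext a; simp [mem_loc]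
      rw [this]
      simpa using hdens
  | succ i ih =>
    obtain ⟨Γ, ρ, x, h1, h3, h4, h5, h6⟩ := ih (by omega)
    have hpw : (1:ℝ) ≤ (33/32) ^ i := one_le_pow₀ (by norm_num)
    have hρ : 0 < ρ := lt_of_lt_of_le (by positivity) h3
    have hcD : Γ.card + M ≤ D := by nlinarith
    obtain ⟨Γ', ρ', x', g1, g2, g3, g4, g5⟩ := step A h2 hno D Γ ρ hρ h4 x ((33/32) ^ i * α) R (by positivity)
      (by nlinarith) hR m k M hm1 hm hk hM hcD h5 (by
        refine (hsize Γ (by omega)).trans (Nat.cast_le.2 (Finset.card_le_card (bohr_mono ?_)))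
        calc 2 * sfac D M R ^ (I + 1) ≤ 2 * sfac D M R ^ (i + 1) := by
              gcongr 2 * ?_
              exact pow_le_pow_of_le_one hs0.le hs1 (by omega)
          _ = sfac D M R * (2 * sfac D M R ^ i) := by ring
          _ ≤ _ := by gcongr) h6
    refine ⟨Γ', ρ', x', ?_, ?_, g3.trans h4, g4, ?_⟩
    · refine g1.trans ?_
      rw [add_mul]; omega
    · refine le_trans ?_ g2
      calc _ = sfac D M R * (2 * sfac D M R ^ i) := by ring
        _ ≤ _ := by gcongr
    · rw [pow_succ]
      refine le_trans (le_of_eq ?_) g5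
      ring

/-- size bound with parameters -/
lemma size_bound (A : Finset G) (h2 : ∀ a b : G, a + a = b + b → a = b)
    (hno : ∀ x : Fin 6 → G, (∀ i, x i ∈ A) → Function.Injective x →
      x 0 + x 1 + x 2 + x 3 + x 4 ≠ 5 • x 5)
    (D I : ℕ) (α R : ℝ)
    (hα : 0 < α) (hRα : 3 ≤ R * α) (hR : 3 ≤ R) (m k M : ℕ) (hm1 : 1 ≤ m) (hm : 20 * R ≤ 4 ^ m)
    (hk : 2 * Real.log (5 * R) * (1600 * m ^ 2) ≤ k) (hM1 : 1 ≤ M)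
    (hM : 8 * Real.log (8 * R ^ k) < M) (hD : (I + 1) * M ≤ D) (J : ℕ)
    (hJ : 1280 * 10240 * 1280 * 1280 * 1600 * 40 * (D ^ 5 * R ^ 2 * M ^ 2) ≤ 2 ^ J)
    (hI : R ≤ (33/32) ^ I)
    (hdens : α * Fintype.card G ≤ A.card) :
    (Fintype.card G : ℝ) ≤ 49 ^ (D * (J * (I + 1))) * (45 * R ^ 2) := by
  by_contra hcon
  push Not at hcon
  have hD1 : 1 ≤ D := by nlinarith
  have hs0 := sfac_pos D M R hD1 hM1 hR
  have hR0 : 0 < R := by linarith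
  have hDr : (1:ℝ) ≤ D := by exact_mod_cast hD1
  have hMr : (1:ℝ) ≤ M := by exact_mod_cast hM1
  have hs1 : sfac D M R ≤ 1 := by
    rw [sfac_eq, div_le_one (by positivity)]
    have h3 : (1:ℝ) ≤ D ^ 5 := one_le_pow₀ hDr
    have h4 : (1:ℝ) ≤ M ^ 2 := one_le_pow₀ hMr
    have h5 : (1:ℝ) ≤ R ^ 2 := one_le_pow₀ (by linarith)
    have : (1:ℝ) ≤ D ^ 5 * R ^ 2 * M ^ 2 := one_le_mul_of_one_le_of_one_le
      (one_le_mul_of_one_le_of_one_le h3 h5) h4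
    linarith
  have hsJ : 1 / 2 ^ J ≤ sfac D M R := by
    rw [sfac_eq]
    exact one_div_le_one_div_of_le (by positivity) hJ
  have hsize : ∀ Γ : Finset (AddChar G ℂ), Γ.card ≤ D →
      45 * R ^ 2 ≤ (bohr Γ (2 * sfac D M R ^ (I + 1))).card := by
    intro Γ hΓ
    have h := bohr_card_lower Γ (J * (I + 1))
    have h3 : (2:ℝ) / 2 ^ (J * (I + 1)) ≤ 2 * sfac D M R ^ (I + 1) := by
      rw [pow_mul, div_eq_mul_one_div, ← one_div_pow]
      gcongr
    have h4 : (bohr Γ ((2:ℝ) / 2 ^ (J * (I + 1)))).card ≤ (bohr Γ (2 * sfac D M R ^ (I + 1))).card :=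
      Finset.card_le_card (bohr_mono h3)
    have h5 : Fintype.card G ≤ 49 ^ (D * (J * (I + 1))) * (bohr Γ (2 * sfac D M R ^ (I + 1))).card := by
      refine h.trans (Nat.mul_le_mul (Nat.pow_le_pow_right (by norm_num) ?_) h4)
      exact Nat.mul_le_mul_right _ hΓ
    have h6 : (Fintype.card G : ℝ) ≤ 49 ^ (D * (J * (I + 1))) *
        (bohr Γ (2 * sfac D M R ^ (I + 1))).card := by exact_mod_cast h5
    have h7 := hcon.le.trans h6
    exact le_of_mul_le_mul_left h7 (by positivity)
  obtain ⟨Γ, ρ, x, g1, g2, g3, g4, g5⟩ := iterate_step A h2 hno D I α R hα hRα hR m k M hm1 hm hk hM1 hM hD hs1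
    hsize hdens I le_rfl
  have hρ : 0 < ρ := lt_of_lt_of_le (by positivity) g2
  have hB : (0:ℝ) < (bohr Γ ρ).card := by exact_mod_cast bohr_card_pos (Γ := Γ) hρ.le
  have h8 : ((loc A x (bohr Γ ρ)).card : ℝ) ≤ (bohr Γ ρ).card := by exact_mod_cast loc_card_le _ _ _
  have h9 : 3 ≤ (33/32 : ℝ) ^ I * α := hRα.trans (by gcongr)
  nlinarith

end iter

lemma log_num : Real.log 20 ≤ 3 ∧ Real.log 5 ≤ 2 ∧ Real.log 8 ≤ 3 ∧ Real.log 45 ≤ 4 ∧ Real.log 49 ≤ 4 := by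
  have he : (2.718:ℝ) < Real.exp 1 := by have := Real.exp_one_gt_d9; linarith
  have hp : ∀ n : ℕ, (2.718:ℝ) ^ n ≤ Real.exp n := by
    intro n
    rw [← Real.exp_one_pow]
    gcongr
  have hl : ∀ (n : ℕ) (x : ℝ), 0 < x → x ≤ (2.718:ℝ) ^ n → Real.log x ≤ n := by
    intro n x hx h
    rw [Real.log_le_iff_le_exp hx]
    exact h.trans (hp n)
  have a := hl 3 20 (by norm_num) (by norm_num)
  have b := hl 2 5 (by norm_num) (by norm_num)
  have c := hl 3 8 (by norm_num) (by norm_num)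
  have d := hl 4 45 (by norm_num) (by norm_num)
  have e := hl 4 49 (by norm_num) (by norm_num)
  push_cast at *
  exact ⟨a, b, c, d, e⟩

set_option maxHeartbeats 1000000 in
/-- parameter choice -/
lemma params (K0 : ℝ) (hK01 : 1 ≤ K0) : ∃ C : ℝ, 0 < C ∧ ∀ R : ℝ, 3 ≤ R → ∃ D I m k M J : ℕ, 1 ≤ m ∧ 20 * R ≤ 4 ^ m ∧
    2 * Real.log (5 * R) * (1600 * m ^ 2) ≤ k ∧ 1 ≤ M ∧ 8 * Real.log (8 * R ^ k) < M ∧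
    (I + 1) * M ≤ D ∧
    K0 * ((D:ℝ) ^ 5 * R ^ 2 * M ^ 2) ≤ 2 ^ J ∧ R ≤ (33/32) ^ I ∧
    Real.log (49 ^ (D * (J * (I + 1))) * (45 * R ^ 2)) ≤ C * Real.log R ^ 7 := by
  obtain ⟨n20, n5, n8, n45, n49⟩ := log_num
  obtain ⟨K, hK⟩ : ∃ K : ℝ, K = Real.log K0 := ⟨_, rfl⟩
  have hK0 : 0 ≤ K := by rw [hK]; exact Real.log_nonneg hK01
  have hK00 : 0 < K0 := by linarith
  obtain ⟨c1, hc1⟩ : ∃ c : ℝ, c = 7 * 10 ^ 7 := ⟨_, rfl⟩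
  obtain ⟨c2, hc2⟩ : ∃ c : ℝ, c = 2 * (K + 5 * (Real.log c1 + 5) + 2 + 2 * (Real.log c1 + 5)) + 1 := ⟨_, rfl⟩
  have hlc1 : 0 ≤ Real.log c1 := Real.log_nonneg (by rw [hc1]; norm_num)
  have hc10 : 0 < c1 := by rw [hc1]; norm_num
  have hc20 : 0 < c2 := by rw [hc2]; positivity
  refine ⟨4 * (c1 * (c2 * 35)) + 6, by positivity, ?_⟩
  intro R hR
  have hR0 : 0 < R := by linarith
  set L := Real.log R with hL
  have hL1 : 1 ≤ L := by
    rw [hL, Real.le_log_iff_exp_le hR0]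
    have := Real.exp_one_lt_d9
    linarith
  have hpow : ∀ n : ℕ, 1 ≤ L ^ n := fun n => one_le_pow₀ hL1
  have hL3 := hpow 3
  have hL4 := hpow 4
  -- m
  have l20 : Real.log (20 * R) ≤ 4 * L := by rw [Real.log_mul (by norm_num) hR0.ne']; linarith
  have l5 : Real.log (5 * R) ≤ 3 * L := by rw [Real.log_mul (by norm_num) hR0.ne']; linarith
  have l20' : 0 < Real.log (20 * R) := Real.log_pos (by linarith)
  have l5' : 0 < Real.log (5 * R) := Real.log_pos (by linarith)
  obtain ⟨m, hm⟩ : ∃ m : ℕ, m = ⌈Real.log (20 * R)⌉₊ := ⟨_, rfl⟩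
  have m1 : Real.log (20 * R) ≤ m := by rw [hm]; exact Nat.le_ceil _
  have m2 : (m:ℝ) ≤ 5 * L := by
    have : (m:ℝ) < Real.log (20 * R) + 1 := by rw [hm]; exact Nat.ceil_lt_add_one l20'.le
    linarith
  have m3 : 1 ≤ m := by rw [hm]; exact Nat.one_le_ceil_iff.2 l20'
  have m4 : 20 * R ≤ 4 ^ m := by
    rw [Real.log_le_iff_le_exp (by positivity)] at m1
    refine m1.trans ?_
    rw [← Real.exp_one_pow]
    gcongr
    have := Real.exp_one_lt_d9
    linarith
  -- k
  obtain ⟨k, hk⟩ : ∃ k : ℕ, k = ⌈2 * Real.log (5 * R) * (1600 * m ^ 2)⌉₊ := ⟨_, rfl⟩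
  have k1 : 2 * Real.log (5 * R) * (1600 * m ^ 2) ≤ k := by rw [hk]; exact Nat.le_ceil _
  have k2 : (k:ℝ) ≤ 240001 * L ^ 3 := by
    have h : (k:ℝ) < 2 * Real.log (5 * R) * (1600 * m ^ 2) + 1 := by
      rw [hk]; exact Nat.ceil_lt_add_one (by positivity)
    have h' : 2 * Real.log (5 * R) * (1600 * m ^ 2) ≤ 2 * (3 * L) * (1600 * (5 * L) ^ 2) := by gcongr
    have h'' : 2 * (3 * L) * (1600 * (5 * L) ^ 2) = 240000 * L ^ 3 := by ring
    linarith
  -- M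
  have lM : Real.log (8 * R ^ k) = Real.log 8 + k * L := by
    rw [Real.log_mul (by norm_num) (by positivity), Real.log_pow]
  have lM0 : 0 ≤ Real.log (8 * R ^ k) := by
    rw [lM]; have : 0 ≤ Real.log 8 := Real.log_nonneg (by norm_num)
    positivity
  obtain ⟨M, hM⟩ : ∃ M : ℕ, M = ⌊8 * Real.log (8 * R ^ k)⌋₊ + 1 := ⟨_, rfl⟩
  have M1 : 8 * Real.log (8 * R ^ k) < M := by rw [hM]; push_cast; exact Nat.lt_floor_add_one _
  have M2 : (M:ℝ) ≤ 2000000 * L ^ 4 := by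
    have h : (M:ℝ) ≤ 8 * Real.log (8 * R ^ k) + 1 := by
      rw [hM]; push_cast; gcongr; exact Nat.floor_le (by positivity)
    rw [lM] at h
    have h' : k * L ≤ 240001 * L ^ 3 * L := by gcongr
    have h'' : 240001 * L ^ 3 * L = 240001 * L ^ 4 := by ring
    linarith
  have M3 : 1 ≤ M := by omega
  have M0 : (1:ℝ) ≤ M := by exact_mod_cast M3
  -- I
  obtain ⟨I, hI⟩ : ∃ I : ℕ, I = ⌈33 * L⌉₊ := ⟨_, rfl⟩
  have I1 : 33 * L ≤ I := by rw [hI]; exact Nat.le_ceil _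
  have I2 : (I:ℝ) + 1 ≤ 35 * L := by
    have : (I:ℝ) < 33 * L + 1 := by rw [hI]; exact Nat.ceil_lt_add_one (by positivity)
    linarith
  have I3 : R ≤ (33/32) ^ I := by
    rw [← Real.log_le_log_iff hR0 (by positivity), Real.log_pow]
    have h : (1:ℝ)/33 ≤ Real.log (33/32) := by
      have := Real.one_sub_inv_le_log_of_pos (show (0:ℝ) < 33/32 by norm_num)
      norm_num at this ⊢
      linarith
    calc Real.log R = 33 * L * (1/33) := by rw [← hL]; ring
      _ ≤ I * Real.log (33/32) := by gcongr
  -- D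
  obtain ⟨D, hD⟩ : ∃ D : ℕ, D = (I + 1) * M := ⟨_, rfl⟩
  have D1 : (D:ℝ) ≤ c1 * L ^ 5 := by
    rw [hD]; push_cast
    calc ((I:ℝ) + 1) * M ≤ (35 * L) * (2000000 * L ^ 4) := by gcongr
      _ = c1 * L ^ 5 := by rw [hc1]; ring
  have D0 : (1:ℝ) ≤ D := by
    rw [hD]; push_cast
    have : (0:ℝ) ≤ I := Nat.cast_nonneg _
    nlinarith
  have hMD : (M:ℝ) ≤ D := by
    rw [hD]; push_cast
    have : (0:ℝ) ≤ I := Nat.cast_nonneg _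
    nlinarith
  have hlogD : Real.log D ≤ (Real.log c1 + 5) * L := by
    have h : Real.log D ≤ Real.log (c1 * L ^ 5) := Real.log_le_log (by linarith) D1
    rw [Real.log_mul hc10.ne' (by positivity), Real.log_pow] at h
    have h' : Real.log L ≤ L := (Real.log_le_sub_one_of_pos (by linarith)).trans (by linarith)
    push_cast at h
    nlinarith
  have hlogM : Real.log M ≤ (Real.log c1 + 5) * L := (Real.log_le_log (by linarith) hMD).trans hlogD
  -- J
  obtain ⟨W, hW⟩ : ∃ W : ℝ, W = K0 * ((D:ℝ) ^ 5 * R ^ 2 * M ^ 2) := ⟨_, rfl⟩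
  have D00 : (0:ℝ) < D := by linarith
  have M00 : (0:ℝ) < M := by linarith
  have W0 : 1 ≤ W := by
    have h3 : (1:ℝ) ≤ D ^ 5 := one_le_pow₀ D0
    have h4 : (1:ℝ) ≤ M ^ 2 := one_le_pow₀ M0
    have h5 : (1:ℝ) ≤ R ^ 2 := one_le_pow₀ (by linarith)
    have : (1:ℝ) ≤ D ^ 5 * R ^ 2 * M ^ 2 := one_le_mul_of_one_le_of_one_le
      (one_le_mul_of_one_le_of_one_le h3 h5) h4
    rw [hW]; exact one_le_mul_of_one_le_of_one_le hK01 this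
  have lW : Real.log W = K + (5 * Real.log D + 2 * L + 2 * Real.log M) := by
    rw [hW, Real.log_mul hK00.ne' (by positivity), Real.log_mul (by positivity) (by positivity),
      Real.log_mul (by positivity) (by positivity), Real.log_pow, Real.log_pow, Real.log_pow, ← hK, ← hL]
    push_cast; ring
  have lW0 : 0 ≤ Real.log W := Real.log_nonneg W0
  obtain ⟨J, hJ⟩ : ∃ J : ℕ, J = ⌈2 * Real.log W⌉₊ := ⟨_, rfl⟩
  have J1 : W ≤ 2 ^ J := by
    rw [← Real.log_le_log_iff (by linarith) (by positivity), Real.log_pow]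
    have h : 2 * Real.log W ≤ J := by rw [hJ]; exact Nat.le_ceil _
    have h2 : (1:ℝ)/2 ≤ Real.log 2 := by have := Real.log_two_gt_d9; linarith
    calc Real.log W = 2 * Real.log W * (1/2) := by ring
      _ ≤ J * Real.log 2 := by gcongr
  have J2 : (J:ℝ) ≤ c2 * L := by
    have h : (J:ℝ) < 2 * Real.log W + 1 := by rw [hJ]; exact Nat.ceil_lt_add_one (by positivity)
    rw [lW] at h
    have h' : K ≤ K * L := by nlinarith
    rw [hc2]
    linarith
  refine ⟨D, I, m, k, M, J, m3, m4, k1, M3, M1, hD.ge, by rw [← hW]; exact J1, I3, ?_⟩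
  rw [Real.log_mul (by positivity) (by positivity), Real.log_mul (by norm_num) (by positivity),
    Real.log_pow, Real.log_pow, ← hL]
  push_cast
  have h7 : (D:ℝ) * (J * (I + 1)) * Real.log 49 ≤ (c1 * L ^ 5) * ((c2 * L) * (35 * L)) * 4 := by
    have : 0 ≤ Real.log 49 := Real.log_nonneg (by norm_num)
    gcongr
  have h8 : (c1 * L ^ 5) * ((c2 * L) * (35 * L)) * 4 = 4 * (c1 * (c2 * 35)) * L ^ 7 := by ring
  have h9 : L ≤ L ^ 7 := by
    calc L = L ^ 1 := by ring
      _ ≤ L ^ 7 := pow_le_pow_right₀ hL1 (by norm_num)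
  have h10 := hpow 7
  rw [add_mul]
  linarith

theorem fin_main : ∃ C : ℝ, 0 < C ∧ ∀ (G : Type) [AddCommGroup G] [Fintype G] [DecidableEq G]
    (A : Finset G), (∀ a b : G, a + a = b + b → a = b) →
    (∀ x : Fin 6 → G, (∀ i, x i ∈ A) → Function.Injective x →
      x 0 + x 1 + x 2 + x 3 + x 4 ≠ 5 • x 5) → ∀ R : ℝ, 3 ≤ R → 3 * (Fintype.card G : ℝ) ≤ R * A.card →
    Real.log (Fintype.card G) ≤ C * Real.log R ^ 7 := by
  obtain ⟨C, hC, h⟩ := params (1280 * 10240 * 1280 * 1280 * 1600 * 40) (by norm_num)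
  refine ⟨C, hC, ?_⟩
  intro G _ _ _ A h2 hno R hR hRA
  obtain ⟨D, I, m, k, M, J, g1, g2, g3, g4, g5, g6, g7, g8, g9⟩ := h R hR
  have hG : (0:ℝ) < Fintype.card G := by exact_mod_cast Fintype.card_pos
  have hR0 : 0 < R := by linarith
  have := size_bound A h2 hno D I (A.card / Fintype.card G) R (by
      refine div_pos ?_ hG
      by_contra hcon
      nlinarith) (by rw [← mul_div_assoc, le_div_iff₀ hG]; exact hRA) hR m k M g1 g2 g3 g4 g5 g6 J g7 g8
      (by rw [div_mul_cancel₀ _ hG.ne'])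
  exact (Real.log_le_log hG this).trans g9

end SSix

namespace SSix

/-- a generic homomorphism to the integers -/
lemma exists_generic (d : ℕ) (S : Finset (Fin d → ℤ)) :
    ∃ ψ : (Fin d → ℤ) →+ ℤ, ∀ w ∈ S, w ≠ 0 → ψ w ≠ 0 := by
  classical
  let p : (Fin d → ℤ) →+ Polynomial ℤ :=
    { toFun := fun w => ∑ i : Fin d, Polynomial.monomial (i : ℕ) (w i)
      map_zero' := by simp
      map_add' := by intro a b; simp [Finset.sum_add_distrib] }
  have hp : ∀ w, w ≠ 0 → p w ≠ 0 := by
    intro w hw h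
    apply hw
    funext i
    have h1 : (p w).coeff (i : ℕ) = 0 := by rw [h]; simp
    have h2 : (p w).coeff (i : ℕ) = w i := by
      show (∑ j : Fin d, Polynomial.monomial (j : ℕ) (w j)).coeff (i : ℕ) = w i
      rw [Polynomial.finsetSum_coeff]
      simp only [Polynomial.coeff_monomial]
      rw [Finset.sum_eq_single i]
      · simp
      · intro j _ hj
        rw [if_neg]
        intro h
        exact hj (Fin.ext h)
      · simp
    rw [← h2, h1]; rfl
  let P : Polynomial ℤ := ∏ w ∈ S.filter (fun w => w ≠ 0), p w
  have hP : P ≠ 0 := by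
    refine Finset.prod_ne_zero_iff.2 ?_
    intro w hw
    exact hp w (Finset.mem_filter.1 hw).2
  obtain ⟨t, ht⟩ : ∃ t : ℤ, P.eval t ≠ 0 := by
    by_contra hcon
    push Not at hcon
    exact hP (Polynomial.funext (by simpa using hcon))
  refine ⟨(Polynomial.evalRingHom t).toAddMonoidHom.comp p, ?_⟩
  intro w hw hw0 h
  apply ht
  have h' : (p w).eval t = 0 := h
  show (∏ w ∈ S.filter (fun w => w ≠ 0), p w).eval t = 0
  rw [Polynomial.eval_prod]
  exact Finset.prod_eq_zero (Finset.mem_filter.2 ⟨hw, hw0⟩) h'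

lemma to_int (n : ℕ) (A : Finset (Fin n → ℝ))
    (hno : ∀ x : Fin 6 → Fin n → ℝ, (∀ i, x i ∈ A) → Function.Injective x →
          x 0 + x 1 + x 2 + x 3 + x 4 ≠ (5 : ℝ) • x 5) :
    ∃ B : Finset ℤ, B.card = A.card ∧ (B + B).card ≤ (A + A).card ∧
      (∀ x : Fin 6 → ℤ, (∀ i, x i ∈ B) → Function.Injective x →
        x 0 + x 1 + x 2 + x 3 + x 4 ≠ 5 * x 5) := by
  classical
  let H : Submodule ℤ (Fin n → ℝ) := Submodule.span ℤ (A : Set (Fin n → ℝ))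
  have : Module.Finite ℤ H := Module.Finite.span_finset ℤ A
  have : Module.Free ℤ H := inferInstance
  let e := Module.finBasis ℤ H
  have hA : ∀ a ∈ A, a ∈ H := fun a ha => Submodule.subset_span ha
  let c : A → H := fun a => ⟨a.1, hA a.1 a.2⟩
  let f : H ≃ₗ[ℤ] (Fin (Module.finrank ℤ H) → ℤ) := e.equivFun
  let S1 : Finset (Fin (Module.finrank ℤ H) → ℤ) :=
    Finset.univ.image (fun ab : A × A => f (c ab.1 - c ab.2))
  let S2 : Finset (Fin (Module.finrank ℤ H) → ℤ) :=
    Finset.univ.image (fun x : Fin 6 → A => f (c (x 0) + c (x 1) + c (x 2) + c (x 3) + c (x 4) - (5:ℤ) • c (x 5)))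
  obtain ⟨ψ, hψ⟩ := exists_generic _ (S1 ∪ S2)
  let g : H →+ ℤ := ψ.comp f.toLinearMap.toAddMonoidHom
  have gdef : ∀ h, g h = ψ (f h) := fun h => rfl
  have inj : Function.Injective (fun a : A => g (c a)) := by
    intro a b hab
    by_contra hne
    have h1 : f (c a - c b) ∈ S1 ∪ S2 :=
      Finset.mem_union_left _ (Finset.mem_image.2 ⟨(a, b), Finset.mem_univ _, rfl⟩)
    refine hψ _ h1 ?_ ?_
    · intro h
      rw [LinearEquiv.map_eq_zero_iff, sub_eq_zero] at h
      apply hne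
      exact Subtype.ext (congrArg (fun z : H => z.1) h)
    · rw [← gdef, map_sub]
      simpa [sub_eq_zero] using hab
  refine ⟨Finset.univ.image (fun a : A => g (c a)), ?_, ?_, ?_⟩
  · rw [Finset.card_image_of_injective _ inj]; simp
  · let G : (Fin n → ℝ) → ℤ := fun v => if h : v ∈ H then g ⟨v, h⟩ else 0
    refine (Finset.card_le_card (t := (A + A).image G) ?_).trans Finset.card_image_le
    intro z hz
    obtain ⟨u, hu, v, hv, rfl⟩ := Finset.mem_add.1 hz
    obtain ⟨a, _, rfl⟩ := Finset.mem_image.1 hu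
    obtain ⟨b, _, rfl⟩ := Finset.mem_image.1 hv
    refine Finset.mem_image.2 ⟨a.1 + b.1, Finset.add_mem_add a.2 b.2, ?_⟩
    have h : a.1 + b.1 ∈ H := H.add_mem (hA _ a.2) (hA _ b.2)
    show (if h : a.1 + b.1 ∈ H then g ⟨a.1 + b.1, h⟩ else 0) = _
    rw [dif_pos h, ← map_add]
    rfl
  · intro y hy yinj heq
    have : ∀ i, ∃ a : A, g (c a) = y i := by
      intro i
      obtain ⟨a, _, h⟩ := Finset.mem_image.1 (hy i)
      exact ⟨a, h⟩
    choose x hx using this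
    have h1 : f (c (x 0) + c (x 1) + c (x 2) + c (x 3) + c (x 4) - (5:ℤ) • c (x 5)) ∈ S1 ∪ S2 :=
      Finset.mem_union_right _ (Finset.mem_image.2 ⟨x, Finset.mem_univ _, rfl⟩)
    refine hψ _ h1 ?_ ?_
    · intro h
      rw [LinearEquiv.map_eq_zero_iff, sub_eq_zero] at h
      refine hno (fun i => (x i).1) (fun i => (x i).2) ?_ ?_
      · intro i j hij
        apply yinj
        rw [← hx i, ← hx j, Subtype.ext hij]
      · have h2 := congrArg (fun z : H => z.1) h
        have h3 : (x 0).1 + (x 1).1 + (x 2).1 + (x 3).1 + (x 4).1 = (5:ℤ) • (x 5).1 := h2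
        show (x 0).1 + (x 1).1 + (x 2).1 + (x 3).1 + (x 4).1 = (5:ℝ) • (x 5).1
        rw [h3]
        ext i
        simp
    · rw [← gdef]
      simp only [map_sub, map_add, map_zsmul, hx, smul_eq_mul]
      linarith

/-- a good dilation exists -/
lemma good_q (S : Finset ℤ) (N : ℕ) (hN : 2 * S.card < N) :
    ∃ p : ℕ, p.Prime ∧ ∃ q : ℤ, ∀ w ∈ S, w ≠ 0 → ∀ T : ℤ, |T| < p → (p : ℤ) ∣ T - q * w → ¬ (N : ℤ) ∣ T := by
  classical
  obtain ⟨p, hp1, hp⟩ := Nat.exists_infinite_primes (2 + ∑ w ∈ S, w.natAbs)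
  refine ⟨p, hp, ?_⟩
  have hpw : ∀ w ∈ S, w ≠ 0 → ¬ (p:ℤ) ∣ w := by
    intro w hw hw0 h
    have h1 : p ∣ w.natAbs := Int.natCast_dvd.1 h
    have h2 := Nat.le_of_dvd (Int.natAbs_pos.2 hw0) h1
    have h3 : w.natAbs ≤ ∑ w ∈ S, w.natAbs := Finset.single_le_sum (f := fun w : ℤ => w.natAbs) (fun _ _ => Nat.zero_le _) hw
    omega
  have hpi : Prime (p:ℤ) := Nat.prime_iff_prime_int.1 hp
  by_contra hcon
  push Not at hcon
  let Q : Finset ℤ := Finset.Icc 1 ((p:ℤ) - 1)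
  have hQ : Q.card = p - 1 := by simp [Q]
  let bad : ℤ → Finset ℤ := fun w => Q.filter (fun q => ∃ T : ℤ, |T| < p ∧ (p : ℤ) ∣ T - q * w ∧ (N : ℤ) ∣ T)
  have hN0 : 0 < N := by omega
  have hbad : ∀ w ∈ S, w ≠ 0 → (bad w).card ≤ 2 * ((p - 1) / N) := by
    intro w hw hw0
    have : ∀ q ∈ bad w, ∃ t : ℤ, |t * N| < p ∧ (p : ℤ) ∣ t * N - q * w := by
      intro q hq
      obtain ⟨_, T, h1, h2, t, rfl⟩ := Finset.mem_filter.1 hq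
      exact ⟨t, by rwa [mul_comm], by rwa [mul_comm t]⟩
    choose! t ht using this
    have hcard : ((Finset.Icc (-(((p - 1) / N : ℕ) : ℤ)) (((p - 1) / N : ℕ) : ℤ)).erase 0).card
        = 2 * ((p - 1) / N) := by
      clear ht hcon
      generalize (p - 1) / N = M
      rw [Finset.card_erase_of_mem (by rw [Finset.mem_Icc]; constructor <;> omega), Int.card_Icc]
      omega
    rw [← hcard]
    refine Finset.card_le_card_of_injOn t ?_ ?_
    · intro q hq
      have hq : q ∈ bad w := hq
      obtain ⟨h1, h2⟩ := ht q hq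
      have hqQ := Finset.mem_Icc.1 (Finset.mem_filter.1 hq).1
      refine Finset.mem_coe.2 (Finset.mem_erase.2 ⟨?_, ?_⟩)
      · intro h0
        rw [h0, zero_mul, zero_sub, dvd_neg] at h2
        rcases hpi.dvd_mul.1 h2 with h3 | h3
        · have := Int.le_of_dvd (by linarith) h3
          linarith
        · exact hpw w hw hw0 h3
      · rw [Finset.mem_Icc, ← abs_le]
        push_cast
        rw [Int.le_ediv_iff_mul_le (by exact_mod_cast hN0)]
        rw [abs_mul, Nat.abs_cast] at h1
        rw [Nat.cast_sub hp.one_lt.le]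
        push_cast
        linarith
    · intro q hq q' hq' hqq
      have hq : q ∈ bad w := hq
      have hq' : q' ∈ bad w := hq'
      have h1 := (ht q hq).2
      have h2 := (ht q' hq').2
      have hqQ := Finset.mem_Icc.1 (Finset.mem_filter.1 hq).1
      have hqQ' := Finset.mem_Icc.1 (Finset.mem_filter.1 hq').1
      rw [← hqq] at h2
      have h3 := dvd_sub h1 h2
      have h4 : t q * N - q * w - (t q * N - q' * w) = (q' - q) * w := by ring
      rw [h4] at h3
      rcases hpi.dvd_mul.1 h3 with h5 | h5
      · have := Int.eq_zero_of_abs_lt_dvd h5 (by rw [abs_lt]; constructor <;> linarith)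
        linarith
      · exact absurd h5 (hpw w hw hw0)
  have hcov : Q ⊆ (S.filter (fun w => w ≠ 0)).biUnion bad := by
    intro q hq
    obtain ⟨w, hw, hw0, T, h1, h2, h3⟩ := hcon q
    exact Finset.mem_biUnion.2 ⟨w, Finset.mem_filter.2 ⟨hw, hw0⟩, Finset.mem_filter.2 ⟨hq, T, h1, h2, h3⟩⟩
  have h1 := (Finset.card_le_card hcov).trans (Finset.card_biUnion_le_card_mul _ _ (2 * ((p - 1) / N))
    (fun w hw => hbad w (Finset.mem_filter.1 hw).1 (Finset.mem_filter.1 hw).2))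
  rw [hQ] at h1
  have h2 : (S.filter (fun w => w ≠ 0)).card ≤ S.card := Finset.card_filter_le _ _
  have h3 : (p - 1) / N * N ≤ p - 1 := Nat.div_mul_le_self _ _
  have h4 : 0 < p - 1 := by have := hp.one_lt; omega
  have h5 : p - 1 ≤ S.card * (2 * ((p - 1) / N)) := h1.trans (Nat.mul_le_mul_right _ h2)
  generalize (p - 1) / N = M at *
  rcases Nat.eq_zero_or_pos M with h0 | h0
  · subst h0; omega
  · nlinarith

lemma to_zmod (B S : Finset ℤ) (hS1 : ∀ a ∈ B, ∀ b ∈ B, a - b ∈ S)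
    (hS2 : ∀ x : Fin 6 → ℤ, (∀ i, x i ∈ B) → x 0 + x 1 + x 2 + x 3 + x 4 - 5 * x 5 ∈ S)
    (hno : ∀ x : Fin 6 → ℤ, (∀ i, x i ∈ B) → Function.Injective x →
        x 0 + x 1 + x 2 + x 3 + x 4 ≠ 5 * x 5) (N : ℕ) (hN : 2 * S.card < N) :
    ∃ E : Finset (ZMod N), B.card ≤ 5 * E.card ∧
      (∀ x : Fin 6 → ZMod N, (∀ i, x i ∈ E) → Function.Injective x →
        x 0 + x 1 + x 2 + x 3 + x 4 ≠ 5 • x 5) := by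
  classical
  obtain ⟨p, hp, q, hq⟩ := good_q S N hN
  have hp0 : (0:ℤ) < p := by exact_mod_cast hp.pos
  let r : ℤ → ℤ := fun x => (q * x) % p
  have r0 : ∀ x, 0 ≤ r x := fun x => Int.emod_nonneg _ hp0.ne'
  have r1 : ∀ x, r x < p := fun x => Int.emod_lt_of_pos _ hp0
  have r2 : ∀ x, ∃ t, r x = q * x + p * t := by
    intro x
    refine ⟨-(q * x / p), ?_⟩
    have := Int.emod_add_mul_ediv (q * x) p
    show (q * x) % p = _
    linarith
  obtain ⟨j, hj, hjc⟩ : ∃ j ∈ Finset.Icc (0:ℤ) 4, B.card ≤ 5 * (B.filter (fun x => 5 * r x / p = j)).card := by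
    by_contra hcon
    push Not at hcon
    have h1 : B.card = ∑ j ∈ Finset.Icc (0:ℤ) 4, (B.filter (fun x => 5 * r x / p = j)).card := by
      refine Finset.card_eq_sum_card_fiberwise ?_
      intro x _
      refine Finset.mem_coe.2 (Finset.mem_Icc.2 ⟨Int.ediv_nonneg (by have := r0 x; linarith) hp0.le, ?_⟩)
      have : 5 * r x / p < 5 := by
        rw [Int.ediv_lt_iff_lt_mul hp0]; have := r1 x; linarith
      linarith
    have h2 : ∑ j ∈ Finset.Icc (0:ℤ) 4, 5 * (B.filter (fun x => 5 * r x / p = j)).card <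
        ∑ j ∈ Finset.Icc (0:ℤ) 4, B.card := Finset.sum_lt_sum_of_nonempty ⟨0, by simp⟩ hcon
    rw [← Finset.mul_sum, ← h1] at h2
    simp at h2
  set B' := B.filter (fun x => 5 * r x / p = j) with hB'
  have hclose : ∀ x ∈ B', j * p ≤ 5 * r x ∧ 5 * r x < j * p + p := by
    intro x hx
    have h := (Finset.mem_filter.1 hx).2
    have h1 := Int.emod_add_mul_ediv (5 * r x) p
    have h2 := Int.emod_nonneg (5 * r x) hp0.ne'
    have h3 := Int.emod_lt_of_pos (5 * r x) hp0
    rw [h] at h1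
    constructor <;> linarith [mul_comm j (p:ℤ)]
  have hsub : ∀ x ∈ B', x ∈ B := fun x hx => (Finset.mem_filter.1 hx).1
  let φ : ℤ → ZMod N := fun x => ((r x : ℤ) : ZMod N)
  have φinj : ∀ x ∈ B', ∀ y ∈ B', φ x = φ y → x = y := by
    intro x hx y hy h
    by_contra hne
    have h1 : (N:ℤ) ∣ r x - r y := by
      rw [← ZMod.intCast_zmod_eq_zero_iff_dvd]
      push_cast
      exact sub_eq_zero.2 h
    refine hq (x - y) (hS1 x (hsub x hx) y (hsub y hy)) (sub_ne_zero.2 hne) (r x - r y) ?_ ?_ h1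
    · have := r0 x; have := r1 x; have := r0 y; have := r1 y
      rw [abs_lt]; constructor <;> linarith
    · obtain ⟨s, hs⟩ := r2 x
      obtain ⟨t, ht⟩ := r2 y
      exact ⟨s - t, by rw [hs, ht]; ring⟩
  refine ⟨B'.image φ, ?_, ?_⟩
  · rw [Finset.card_image_of_injOn (fun x hx y hy h => φinj x hx y hy h)]
    exact hjc
  · intro y hy yinj heq
    have : ∀ i, ∃ a ∈ B', φ a = y i := fun i => Finset.mem_image.1 (hy i)
    choose x hxB hx using this
    have xinj : Function.Injective x := by
      intro i j hij
      apply yinj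
      rw [← hx, ← hx, hij]
    have h1 := hno x (fun i => hsub _ (hxB i)) xinj
    have h2 := hS2 x (fun i => hsub _ (hxB i))
    refine hq _ h2 (sub_ne_zero.2 h1) (r (x 0) + r (x 1) + r (x 2) + r (x 3) + r (x 4) - 5 * r (x 5)) ?_ ?_ ?_
    · have c0 := hclose _ (hxB 0)
      have c1 := hclose _ (hxB 1)
      have c2 := hclose _ (hxB 2)
      have c3 := hclose _ (hxB 3)
      have c4 := hclose _ (hxB 4)
      have c5 := hclose _ (hxB 5)
      rw [abs_lt]; constructor <;> linarith
    · obtain ⟨t0, e0⟩ := r2 (x 0)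
      obtain ⟨t1, e1⟩ := r2 (x 1)
      obtain ⟨t2, e2⟩ := r2 (x 2)
      obtain ⟨t3, e3⟩ := r2 (x 3)
      obtain ⟨t4, e4⟩ := r2 (x 4)
      obtain ⟨t5, e5⟩ := r2 (x 5)
      exact ⟨t0 + t1 + t2 + t3 + t4 - 5 * t5, by rw [e0, e1, e2, e3, e4, e5]; ring⟩
    · rw [← ZMod.intCast_zmod_eq_zero_iff_dvd]
      push_cast
      rw [sub_eq_zero]
      have := heq
      rw [← hx 0, ← hx 1, ← hx 2, ← hx 3, ← hx 4, ← hx 5] at this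
      simpa [φ, nsmul_eq_mul] using this

lemma sumset5 (B : Finset ℤ) (hB : B.Nonempty) : ∃ S : Finset ℤ,
    (∀ a ∈ B, ∀ b ∈ B, a - b ∈ S) ∧
    (∀ x : Fin 6 → ℤ, (∀ i, x i ∈ B) → x 0 + x 1 + x 2 + x 3 + x 4 - 5 * x 5 ∈ S) ∧
    (S.card : ℝ) ≤ (((B + B).card : ℝ) / B.card) ^ 10 * B.card := by
  have h := Finset.pluennecke_ruzsa_inequality_nsmul_sub_nsmul_add hB B 5 5
  have h5 : ∀ a b c d e : ℤ, a ∈ B → b ∈ B → c ∈ B → d ∈ B → e ∈ B → a + b + c + d + e ∈ 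
      (B + B + B + B + B) := by
    intro a b c d e ha hb hc hd he
    exact Finset.add_mem_add (Finset.add_mem_add (Finset.add_mem_add (Finset.add_mem_add ha hb) hc) hd) he
  simp only [succ_nsmul, zero_nsmul, zero_add] at h
  refine ⟨(B + B + B + B + B) - (B + B + B + B + B), ?_, ?_, ?_⟩
  · intro a ha b hb
    have := Finset.sub_mem_sub (h5 a a a a a ha ha ha ha ha) (h5 b a a a a hb ha ha ha ha)
    convert this using 1; ring
  · intro x hx
    have := Finset.sub_mem_sub (h5 _ _ _ _ _ (hx 0) (hx 1) (hx 2) (hx 3) (hx 4))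
      (h5 _ _ _ _ _ (hx 5) (hx 5) (hx 5) (hx 5) (hx 5))
    convert this using 1; ring
  · have h' := (NNRat.cast_le (K := ℝ)).2 h
    push_cast at h'
    exact h'

end SSix

namespace SSix

lemma odd_inj (k : ℕ) : ∀ a b : ZMod (2 * k + 1), a + a = b + b → a = b := by
  intro a b h
  have h1 : ((2 * k + 1 : ℕ) : ZMod (2 * k + 1)) = 0 := ZMod.natCast_self _
  push_cast at h1
  linear_combination (-(k : ZMod (2 * k + 1))) * h + (a - b) * h1

/-- the integer case, in quantitative form -/
theorem int_main : ∃ C : ℝ, 0 < C ∧ ∀ B : Finset ℤ, B.Nonempty →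
    (∀ x : Fin 6 → ℤ, (∀ i, x i ∈ B) → Function.Injective x →
        x 0 + x 1 + x 2 + x 3 + x 4 ≠ 5 * x 5) →
    Real.log B.card ≤ C * Real.log (45 * (((B + B).card : ℝ) / B.card) ^ 10) ^ 7 := by
  obtain ⟨C, hC, h⟩ := fin_main
  refine ⟨C, hC, ?_⟩
  intro B hB hno
  obtain ⟨S, hS1, hS2, hS3⟩ := sumset5 B hB
  obtain ⟨E, hE1, hE2⟩ := to_zmod B S hS1 hS2 hno (2 * S.card + 1) (by omega)
  obtain ⟨b, hb⟩ := hB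
  have hB0 : (0:ℝ) < B.card := by exact_mod_cast Finset.card_pos.2 ⟨b, hb⟩
  have hBS : B.card ≤ S.card :=
    Finset.card_le_card_of_injOn (fun a => a - b) (fun a ha => hS1 a ha b hb)
      (fun x _ y _ hxy => by simpa using hxy)
  have hBB : B.card ≤ (B + B).card := Finset.card_le_card_add_right ⟨b, hb⟩
  have hK : (1:ℝ) ≤ ((B + B).card : ℝ) / B.card := by
    rw [le_div_iff₀ hB0, one_mul]; exact_mod_cast hBB
  have hK10 : (1:ℝ) ≤ (((B + B).card : ℝ) / B.card) ^ 10 := one_le_pow₀ hK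
  have hc : Fintype.card (ZMod (2 * S.card + 1)) = 2 * S.card + 1 := ZMod.card _
  have h1 : (1:ℝ) ≤ B.card := by exact_mod_cast Finset.card_pos.2 ⟨b, hb⟩
  have h2 : (B.card : ℝ) ≤ S.card := by exact_mod_cast hBS
  have h3 : (B.card : ℝ) ≤ 5 * E.card := by exact_mod_cast hE1
  have := h (ZMod (2 * S.card + 1)) E (odd_inj _) hE2 (45 * (((B + B).card : ℝ) / B.card) ^ 10)
    (by linarith) (by
      rw [hc]; push_cast
      generalize (((B + B).card : ℝ) / B.card) ^ 10 = K at *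
      have h4 : K * B.card ≤ K * (5 * E.card) := by gcongr
      linarith)
  rw [hc] at this
  refine le_trans (Real.log_le_log hB0 ?_) this
  push_cast
  linarith

theorem final_main : ∃ C : ℝ, 0 < C ∧ ∃ N : ℕ, ∀ n : ℕ, 1 ≤ n →
      ∀ A : Set (Fin n → ℝ), A.Finite → N ≤ A.ncard →
        (∀ x : Fin 6 → Fin n → ℝ, (∀ i, x i ∈ A) → Function.Injective x →
          x 0 + x 1 + x 2 + x 3 + x 4 ≠ (5 : ℝ) • x 5) →
        (A.ncard : ℝ) * Real.exp (C * Real.log (A.ncard) ^ ((1 : ℝ) / 7)) ≤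
          ((A + A).ncard : ℝ) := by
  classical
  obtain ⟨C, hC, h⟩ := int_main
  have hCr : 0 < C⁻¹ ^ ((1:ℝ)/7) := by positivity
  refine ⟨C⁻¹ ^ ((1:ℝ)/7) / 20, by positivity, ⌈Real.exp (C * 8 ^ 7)⌉₊, ?_⟩
  intro n _ A hfin hN hno
  obtain ⟨A, rfl⟩ : ∃ F : Finset (Fin n → ℝ), A = F := ⟨hfin.toFinset, by simp⟩
  rw [Set.ncard_coe_finset] at hN ⊢
  rw [← Finset.coe_add, Set.ncard_coe_finset]
  obtain ⟨B, hB1, hB2, hB3⟩ := to_int n A (by simpa using hno)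
  have hN' : Real.exp (C * 8 ^ 7) ≤ A.card := Nat.ceil_le.1 hN
  have hA0 : (0:ℝ) < A.card := lt_of_lt_of_le (Real.exp_pos _) hN'
  have hlog : C * 8 ^ 7 ≤ Real.log A.card := (Real.le_log_iff_exp_le hA0).2 hN'
  have hBn : B.Nonempty := by
    rw [← Finset.card_pos, hB1]; exact_mod_cast hA0
  have h1 := h B hBn hB3
  rw [hB1] at h1
  have hBB : B.card ≤ (B + B).card := Finset.card_le_card_add_right hBn
  have hBB0 : (0:ℝ) < (B + B).card := by
    have : (B.card : ℝ) ≤ (B + B).card := by exact_mod_cast hBB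
    rw [hB1] at this
    linarith
  have hK : (1:ℝ) ≤ ((B + B).card : ℝ) / A.card := by
    rw [le_div_iff₀ hA0, one_mul, ← hB1]; exact_mod_cast hBB
  set K := ((B + B).card : ℝ) / A.card with hKdef
  have hK0 : 0 < K := by linarith
  have n45 := log_num.2.2.2.1
  rw [Real.log_mul (by norm_num) (by positivity), Real.log_pow] at h1
  push_cast at h1
  have lK : 0 ≤ Real.log K := Real.log_nonneg hK
  have l45 : 0 ≤ Real.log 45 := Real.log_nonneg (by norm_num)
  obtain ⟨Y, hY⟩ : ∃ Y : ℝ, Y = Real.log 45 + 10 * Real.log K := ⟨_, rfl⟩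
  rw [← hY] at h1
  have hY0 : 0 ≤ Y := by rw [hY]; positivity
  have lA : 0 ≤ Real.log A.card := le_trans (by positivity) hlog
  obtain ⟨Z, hZ⟩ : ∃ Z : ℝ, Z = (C⁻¹ * Real.log A.card) ^ ((1:ℝ)/7) := ⟨_, rfl⟩
  have hZ8 : 8 ≤ Z := by
    have h8 : (8:ℝ) = ((8:ℝ) ^ 7) ^ ((1:ℝ)/7) := by
      rw [← Real.rpow_natCast, ← Real.rpow_mul (by norm_num)]; norm_num
    rw [h8, hZ]
    refine Real.rpow_le_rpow (by positivity) ?_ (by positivity)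
    rw [inv_mul_eq_div, le_div_iff₀ hC]
    linarith
  have hZY : Z ≤ Y := by
    have h8 : Y = (Y ^ 7) ^ ((1:ℝ)/7) := by
      rw [← Real.rpow_natCast, ← Real.rpow_mul hY0]; norm_num
    rw [h8, hZ]
    refine Real.rpow_le_rpow (by positivity) ?_ (by positivity)
    rw [inv_mul_eq_div, div_le_iff₀ hC]
    linarith
  have hkey : Z / 20 ≤ Real.log K := by linarith
  have e1 : C⁻¹ ^ ((1:ℝ)/7) / 20 * Real.log A.card ^ ((1:ℝ)/7) = Z / 20 := by
    rw [hZ, Real.mul_rpow (by positivity) lA]; ring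
  rw [e1]
  have h5 : Real.exp (Z / 20) ≤ K := (Real.le_log_iff_exp_le hK0).1 hkey
  calc (A.card : ℝ) * Real.exp (Z / 20) ≤ A.card * K := by gcongr
    _ = (B + B).card := by rw [hKdef]; field_simp
    _ ≤ (A + A).card := by exact_mod_cast hB2

end SSix

/-- There are `C > 0` and a threshold `N` such that every large
enough finite `A ⊆ ℝ^n` with no solution to
`(1/5)(x₁+x₂+x₃+x₄+x₅) = x₆` in pairwise distinct elements of `A` satisfies
`|A + A| ≥ |A|·exp(C·(log |A|)^{1/7})`. -/
theorem stmt5 :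
    ∃ C : ℝ, 0 < C ∧ ∃ N : ℕ, ∀ n : ℕ, 1 ≤ n →
      ∀ A : Set (Fin n → ℝ), A.Finite → N ≤ A.ncard →
        (∀ x : Fin 6 → Fin n → ℝ, (∀ i, x i ∈ A) → Function.Injective x →
          x 0 + x 1 + x 2 + x 3 + x 4 ≠ (5 : ℝ) • x 5) →
        (A.ncard : ℝ) * Real.exp (C * Real.log (A.ncard) ^ ((1 : ℝ) / 7)) ≤
          ((A + A).ncard : ℝ) := by
  exact SSix.final_main
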